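/- Let n ≥ 1 and let P be a spherical DH-polytope in Sⁿ ⊆ ℝ^{n+1} such that there exists t₀ > −1 with x_n ≥ t₀ for the last coordinate x_n of every x ∈ P (i.e. P avoids the south pole in the last coordinate). Let g(x) = (2x₀/(1+x_n), 2x₁/(1+x_n), …, 2x_{n−1}/(1+x_n)) ∈ ℝⁿ be the stereographic projection from (0,…,0,−1) to the hyperplane x_n = 1, written in the first n coordinates. Then both limits lim_{ε→0⁺} ∫_P (x₀ − εi)^{−n} dσ(x) and lim_{ε→0⁺} ∫_{g(P)} (y₀ − εi)^{−n} dy exist and are equal, where the second integral is with respect to Lebesgue measure on ℝⁿ and y₀ denotes the first coordinate of y. (Proposition 7.2: the hemisphere-model volume μ_h(P) agrees with the upper half-space-model volume μ_u(g(P)).) -/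

import Mathlib

open MeasureTheory Filter Metric

/-- The spherical surface measure on the unit sphere `Sⁿ ⊆ ℝ^{n+1}`, obtained from the
polar decomposition of Lebesgue measure. -/
noncomputable def sphereMeasure (n : ℕ) :
    Measure (sphere (0 : EuclideanSpace ℝ (Fin (n + 1))) 1) :=
  (volume : Measure (EuclideanSpace ℝ (Fin (n + 1)))).toSphere

/-- A *spherical DH-polytope* in `Sⁿ ⊆ ℝ^{n+1}` (hemisphere model of `DHⁿ`): an intersection
of the unit sphere with finitely many closed affine half-spaces whose normal vectors are
nonzero with first coordinate `0`. -/
def IsSphericalDHPolytope (n : ℕ) (P : Set (EuclideanSpace ℝ (Fin (n + 1)))) : Prop :=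
  ∃ S : Finset (EuclideanSpace ℝ (Fin (n + 1)) × ℝ),
    (∀ p ∈ S, p.1 ≠ 0 ∧ p.1 0 = 0) ∧
    P = sphere (0 : EuclideanSpace ℝ (Fin (n + 1))) 1 ∩
      ⋂ p ∈ S, {x : EuclideanSpace ℝ (Fin (n + 1)) | p.2 ≤ inner p.1 x (𝕜 := ℝ)}

section Hyperplane

variable {E : Type} [NormedAddCommGroup E] [InnerProductSpace ℝ E]

theorem inner_add_smul_orthogonal {v : E} (hv : ‖v‖ = 1) (a : ℝ) (z : (ℝ ∙ v)ᗮ) :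
    inner ℝ v (a • v + (z : E)) = a := by
  have : inner ℝ v (z : E) = 0 := Submodule.mem_orthogonal_singleton_iff_inner_right.1 z.2
  simp [inner_add_right, inner_smul_right, this, hv]

theorem norm_sq_smul_add_orthogonal {v : E} (hv : ‖v‖ = 1) (a : ℝ) (z : (ℝ ∙ v)ᗮ) :
    ‖a • v + (z : E)‖ ^ 2 = a ^ 2 + ‖z‖ ^ 2 := by
  have : inner ℝ v (z : E) = 0 := Submodule.mem_orthogonal_singleton_iff_inner_right.1 z.2
  have h := norm_add_sq_real (a • v) (z : E)
  simp only [inner_smul_left, this, norm_smul, hv] at h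
  rw [h]
  simp

variable [FiniteDimensional ℝ E]

theorem finrank_orthogonal_span_unit {v : E} (hv : ‖v‖ = 1) :
    Module.finrank ℝ (ℝ ∙ v)ᗮ + 1 = Module.finrank ℝ E := by
  have h0 : v ≠ 0 := by rintro rfl; simp at hv
  have := Submodule.finrank_add_finrank_orthogonal (ℝ ∙ v)
  rw [finrank_span_singleton h0] at this
  omega

variable [MeasurableSpace E] [BorelSpace E]

/-- Fubini coordinates adapted to a unit vector preserve volume. -/
theorem measurePreserving_smul_add_orthogonal {v : E} (hv : ‖v‖ = 1) :
    MeasurePreserving (fun p : ℝ × (ℝ ∙ v)ᗮ => p.1 • v + (p.2 : E)) := by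
  have h1 := (LinearIsometryEquiv.toSpanUnitSingleton (𝕜 := ℝ) v hv).measurePreserving
  have h2 := h1.prod (MeasurePreserving.id (volume : Measure (ℝ ∙ v)ᗮ))
  have h3 := (WithLp.volume_preserving_toLp (ℝ ∙ v) (ℝ ∙ v)ᗮ)
  have h4 := ((ℝ ∙ v).orthogonalDecomposition).symm.measurePreserving
  have := (h4.comp h3).comp h2
  rw [Measure.volume_eq_prod]
  convert this using 1
  funext p
  simp

theorem measurableEmbedding_smul_add_orthogonal {v : E} (hv : ‖v‖ = 1) :
    MeasurableEmbedding (fun p : ℝ × (ℝ ∙ v)ᗮ => p.1 • v + (p.2 : E)) := by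
  refine Continuous.measurableEmbedding (by fun_prop) ?_
  intro p q h
  simp only at h
  have h1 : p.1 = q.1 := by
    rw [← inner_add_smul_orthogonal hv p.1 p.2, h, inner_add_smul_orthogonal hv]
  rw [h1] at h
  exact Prod.ext h1 (Subtype.ext (add_left_cancel h))

end Hyperplane

theorem exists_smoothTransition_deriv_bound :
    ∃ C : ℝ, 0 ≤ C ∧ ∀ t, |deriv Real.smoothTransition t| ≤ (Set.Icc (0:ℝ) 1).indicator (fun _ => C) t := by
  have hc : Continuous (deriv Real.smoothTransition) :=
    (Real.smoothTransition.contDiff (n := 1)).continuous_deriv le_rfl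
  obtain ⟨C, hC⟩ := (isCompact_Icc (a := (0:ℝ)) (b := 1)).exists_bound_of_continuousOn hc.continuousOn
  have hC0 : 0 ≤ C := (norm_nonneg _).trans (hC 0 (by simp))
  refine ⟨C, hC0, fun t => ?_⟩
  by_cases ht : t ∈ Set.Icc (0:ℝ) 1
  · simpa [ht] using hC t ht
  · rw [Set.indicator_of_notMem ht]
    rw [Set.mem_Icc, not_and_or, not_le, not_le] at ht
    have : deriv Real.smoothTransition t = 0 := by
      rcases ht with ht | ht
      · have : Real.smoothTransition =ᶠ[nhds t] fun _ => 0 := by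
          filter_upwards [gt_mem_nhds ht] with y hy
          exact Real.smoothTransition.zero_of_nonpos hy.le
        rw [this.deriv_eq]; simp
      · have : Real.smoothTransition =ᶠ[nhds t] fun _ => 1 := by
          filter_upwards [lt_mem_nhds ht] with y hy
          exact Real.smoothTransition.one_of_one_le hy.le
        rw [this.deriv_eq]; simp
    simp [this]

theorem integral_deriv_smoothTransition : ∫ t, deriv Real.smoothTransition t = 1 := by
  obtain ⟨C, hC0, hC⟩ := exists_smoothTransition_deriv_bound
  have hd : Differentiable ℝ Real.smoothTransition :=
    (Real.smoothTransition.contDiff (n := 1)).differentiable (by simp)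
  have hc : Continuous (deriv Real.smoothTransition) :=
    (Real.smoothTransition.contDiff (n := 1)).continuous_deriv le_rfl
  have h : ∫ t, deriv Real.smoothTransition t = ∫ t in Set.Icc 0 1, deriv Real.smoothTransition t := by
    refine (setIntegral_eq_integral_of_forall_compl_eq_zero fun t ht => ?_).symm
    have := hC t
    rw [Set.indicator_of_notMem ht] at this
    exact abs_nonpos_iff.1 this
  rw [h, integral_Icc_eq_integral_Ioc, ← intervalIntegral.integral_of_le zero_le_one,
    intervalIntegral.integral_deriv_eq_sub (fun t _ => hd t) (hc.intervalIntegrable _ _)]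
  simp

section Radial

variable {E : Type} [NormedAddCommGroup E] [InnerProductSpace ℝ E]

/-- A continuous function `φ` vanishing outside the ball of radius `R`, together with its
integrable radial derivative `ψ`, which is only required to exist off the sphere of radius `R`. -/
structure IsRadialPair [MeasurableSpace E] [BorelSpace E] [FiniteDimensional ℝ E]
    (R : ℝ) (φ ψ : E → ℂ) : Prop where
  continuous : Continuous φ
  eq_zero : ∀ x, R ≤ ‖x‖ → φ x = 0
  stronglyMeasurable : StronglyMeasurable ψ
  integrable : Integrable ψ
  hasDerivAt : ∀ x, ‖x‖ ≠ R → HasDerivAt (fun t : ℝ => φ (t • x)) (ψ x) 1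

variable [FiniteDimensional ℝ E] [MeasurableSpace E] [BorelSpace E]

namespace IsRadialPair

variable {R : ℝ} {φ ψ : E → ℂ}

theorem hasCompactSupport (h : IsRadialPair R φ ψ) : HasCompactSupport φ := by
  refine HasCompactSupport.of_support_subset_isCompact (isCompact_closedBall (0 : E) R) ?_
  intro x hx
  by_contra hx'
  exact hx (h.eq_zero x (by simpa using (not_le.1 (by simpa using hx')).le))

theorem integrable_left (h : IsRadialPair R φ ψ) : Integrable φ :=
  h.continuous.integrable_of_hasCompactSupport h.hasCompactSupport

theorem hasDerivAt_smul (h : IsRadialPair R φ ψ) {x : E} {t : ℝ} (ht : 0 < t)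
    (hx : ‖t • x‖ ≠ R) : HasDerivAt (fun τ : ℝ => φ (τ • x)) ((t : ℂ)⁻¹ * ψ (t • x)) t := by
  have h1 := h.hasDerivAt (t • x) hx
  have h2 : HasDerivAt (fun τ : ℝ => τ / t) (1 / t) t := (hasDerivAt_id t).div_const t
  have h1' : HasDerivAt (fun u : ℝ => φ (u • t • x)) (ψ (t • x)) (t / t) := by
    rwa [div_self ht.ne']
  have := HasDerivAt.scomp (h := fun τ : ℝ => τ / t) t h1' h2
  refine (this.congr_deriv ?_).congr_of_eventuallyEq (.of_forall fun τ => ?_)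
  · simp
  · simp [smul_smul, div_mul_cancel₀ _ ht.ne']

theorem integral_eq_zero (h : IsRadialPair R φ ψ) (hR : 0 < R) :
    ∫ x, ((Module.finrank ℝ E : ℂ) * φ x + ψ x) = 0 := by
  set k := Module.finrank ℝ E with hk
  set g : E → ℂ := fun x => (k : ℂ) * φ x + ψ x with hg
  have hgm : StronglyMeasurable g :=
    (h.continuous.stronglyMeasurable.const_mul _).add h.stronglyMeasurable
  have hgi : Integrable g := (h.integrable_left.const_mul _).add h.integrable
  set μ : Measure ℝ := volume.restrict (Set.Ioc 1 2)
  have hint : Integrable (fun p : ℝ × E => ((p.1 : ℂ) ^ k * (p.1 : ℂ)⁻¹) * g (p.1 • p.2))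
      (μ.prod volume) := by
    have hm : StronglyMeasurable
        (fun p : ℝ × E => ((p.1 : ℂ) ^ k * (p.1 : ℂ)⁻¹) * g (p.1 • p.2)) := by
      refine StronglyMeasurable.mul ?_ ?_
      · exact Measurable.stronglyMeasurable (by fun_prop)
      · exact hgm.comp_measurable (by fun_prop)
    rw [integrable_prod_iff hm.aestronglyMeasurable]
    constructor
    · filter_upwards [ae_restrict_mem measurableSet_Ioc] with t ht
      exact (hgi.comp_smul (by linarith [ht.1])).const_mul _
    · have hc : IntegrableOn (fun t : ℝ => t⁻¹ * ∫ x, ‖g x‖) (Set.Ioc 1 2) := by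
        refine Integrable.mul_const ?_ _
        refine (ContinuousOn.integrableOn_Icc ?_).mono_set Set.Ioc_subset_Icc_self
        exact continuousOn_inv₀.mono fun t ht => by simp; linarith [ht.1]
      refine Integrable.congr hc ?_
      filter_upwards [ae_restrict_mem measurableSet_Ioc] with t ht
      have ht0 : 0 < t := by linarith [ht.1]
      simp only [norm_mul]
      rw [integral_const_mul, Measure.integral_comp_smul volume (fun x => ‖g x‖) t]
      simp only [norm_pow, norm_inv, Complex.norm_real, Real.norm_of_nonneg ht0.le]
      rw [abs_of_pos (by positivity), smul_eq_mul, ← hk]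
      field_simp
  have hpt : ∀ᵐ x : E, ∫ t in Set.Ioc (1:ℝ) 2, ((t : ℂ) ^ k * (t : ℂ)⁻¹) * g (t • x)
      = (2 : ℂ) ^ k * φ ((2 : ℝ) • x) - φ x := by
    have := hint.swap
    have := ((integrable_prod_iff this.aestronglyMeasurable).1 this).1
    filter_upwards [this] with x hx
    rw [← intervalIntegral.integral_of_le (by norm_num)]
    have key := integral_eq_of_hasDerivAt_off_countable_of_le
      (fun t : ℝ => (t : ℂ) ^ k * φ (t • x)) (fun t => ((t : ℂ) ^ k * (t : ℂ)⁻¹) * g (t • x))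
      (a := 1) (b := 2) (by norm_num) (s := {R / ‖x‖}) (Set.countable_singleton _) ?_ ?_ ?_
    · rw [key]; simp
    · have := h.continuous
      exact Continuous.continuousOn (by fun_prop)
    · rintro t ⟨ht, htR⟩
      have ht0 : 0 < t := by linarith [ht.1]
      have hne : ‖t • x‖ ≠ R := by
        intro hh
        apply htR
        rw [norm_smul, Real.norm_of_nonneg ht0.le] at hh
        have : ‖x‖ ≠ 0 := by
          intro h0
          rw [h0] at hh; simp at hh; linarith
        rw [Set.mem_singleton_iff, eq_div_iff this, hh]
      have h1 := ((hasDerivAt_pow k (t : ℂ)).comp_ofReal).mul (h.hasDerivAt_smul ht0 hne)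
      have ht0' : (t : ℂ) ≠ 0 := by exact_mod_cast ht0.ne'
      refine (h1.congr_deriv ?_)
      simp only [hg]
      rcases k with _ | k
      · simp
      · simp; field_simp; ring
    · rw [intervalIntegrable_iff_integrableOn_Ioc_of_le (by norm_num)]
      exact hx
  have hA : ∫ x : E, ((2 : ℂ) ^ k * φ ((2 : ℝ) • x) - φ x) = 0 := by
    rw [integral_sub ((h.integrable_left.comp_smul (by norm_num)).const_mul _) h.integrable_left,
      integral_const_mul, Measure.integral_comp_smul volume φ 2, ← hk]
    rw [abs_of_pos (by positivity), Complex.real_smul]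
    push_cast
    rw [← mul_assoc, mul_inv_cancel₀ (pow_ne_zero _ two_ne_zero), one_mul, sub_self]
  rw [← integral_congr_ae hpt] at hA
  rw [← integral_integral_swap (f := fun (t : ℝ) (x : E) => ((t : ℂ) ^ k * (t : ℂ)⁻¹) * g (t • x)) hint] at hA
  have hB : ∀ t ∈ Set.Ioc (1:ℝ) 2, ∫ x, ((t : ℂ) ^ k * (t : ℂ)⁻¹) * g (t • x)
      = ((t⁻¹ : ℝ) : ℂ) * ∫ x, g x := by
    intro t ht
    have ht0 : 0 < t := by linarith [ht.1]
    have ht0' : (t : ℂ) ≠ 0 := by exact_mod_cast ht0.ne'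
    rw [integral_const_mul, Measure.integral_comp_smul volume g t, ← hk,
      abs_of_pos (by positivity), Complex.real_smul]
    push_cast
    field_simp
  rw [setIntegral_congr_fun measurableSet_Ioc hB, integral_mul_const, integral_complex_ofReal,
    ← intervalIntegral.integral_of_le (by norm_num), integral_inv_of_pos (by norm_num) (by norm_num)]
    at hA
  refine (mul_eq_zero.1 hA).resolve_left ?_
  have : Real.log (2 / 1) ≠ 0 := by
    rw [div_one]; exact (Real.log_pos (by norm_num)).ne'
  exact_mod_cast this

end IsRadialPair

end Radial

section Faces

theorem integral_prod_comp_affine {F : Type} [MeasureSpace F] [SFinite (volume : Measure F)]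
    (G : ℝ × F → ℂ) (d : ℝ) {δ : ℝ} (hδ : 0 < δ) :
    ∫ p, G p = δ * ∫ p : ℝ × F, G (d + δ * p.1, p.2) := by
  have h1 : (ENNReal.ofReal δ) • Measure.map (fun t => d + δ * t) (volume : Measure ℝ) = volume := by
    have := Real.smul_map_volume_mul_left hδ.ne'
    rw [abs_of_pos hδ] at this
    have h2 : Measure.map (fun t => d + δ * t) (volume : Measure ℝ)
        = Measure.map (fun t => d + t) (Measure.map (fun t => δ * t) volume) := by
      rw [Measure.map_map (by fun_prop) (by fun_prop)]; rfl
    rw [h2, ← Measure.map_smul, this, map_add_left_eq_self]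
  have hemb : MeasurableEmbedding (Prod.map (fun t : ℝ => d + δ * t) (id : F → F)) := by
    refine MeasurableEmbedding.prodMap ?_ MeasurableEmbedding.id
    exact (measurableEmbedding_addLeft d).comp (measurableEmbedding_mulLeft₀ hδ.ne')
  conv_lhs => rw [Measure.volume_eq_prod, ← h1, Measure.prod_smul_left]
  rw [integral_smul_measure, ENNReal.toReal_ofReal hδ.le, Complex.real_smul]
  congr 1
  have h3 := Measure.map_prod_map (volume : Measure ℝ) (volume : Measure F)
    (f := fun t : ℝ => d + δ * t) (g := id) (by fun_prop) measurable_id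
  rw [Measure.map_id] at h3
  rw [h3, hemb.integral_map]
  rfl

variable {E : Type} [NormedAddCommGroup E] [InnerProductSpace ℝ E]

/-- The open polyhedron cut out by a list of strict affine inequalities. -/
def polyhedron (l : List (E × ℝ)) : Set E := {x | ∀ p ∈ l, p.2 < inner ℝ p.1 x}

theorem isOpen_polyhedron (l : List (E × ℝ)) : IsOpen (polyhedron l) := by
  induction l with
  | nil => simp [polyhedron]
  | cons p l ih =>
    have : polyhedron (p :: l) = {x | p.2 < inner ℝ p.1 x} ∩ polyhedron l := by
      ext x; simp [polyhedron]
    rw [this]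
    exact (isOpen_lt (by fun_prop) (by fun_prop)).inter ih

/-- The indicator of a polyhedron is locally constant off the bounding hyperplanes. -/
theorem eventually_mem_polyhedron_iff (l : List (E × ℝ)) {x : E}
    (hx : ∀ p ∈ l, p.1 ≠ 0 → inner ℝ p.1 x ≠ p.2) :
    ∀ᶠ y in nhds x, y ∈ polyhedron l ↔ x ∈ polyhedron l := by
  by_cases h : x ∈ polyhedron l
  · filter_upwards [(isOpen_polyhedron l).mem_nhds h] with y hy
    simp [h, hy]
  · have h' := h
    simp only [polyhedron, Set.mem_ofPred_eq, not_forall, not_lt] at h'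
    obtain ⟨p, hp, hpx⟩ := h'
    by_cases h0 : p.1 = 0
    · rw [h0, inner_zero_left] at hpx
      refine .of_forall fun y => ⟨fun hy => absurd (hy p hp) ?_, fun hy => absurd hy h⟩
      rw [h0, inner_zero_left]; exact not_lt.2 hpx
    · have : inner ℝ p.1 x < p.2 := lt_of_le_of_ne hpx (hx p hp h0)
      have ho : IsOpen {y : E | inner ℝ p.1 y < p.2} := isOpen_lt (by fun_prop) (by fun_prop)
      filter_upwards [ho.mem_nhds this] with y hy
      exact ⟨fun hy' => absurd (hy' p hp) (not_lt.2 (le_of_lt hy)), fun hy' => absurd hy' h⟩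

variable [MeasurableSpace E] [BorelSpace E]

theorem measurableSet_polyhedron (l : List (E × ℝ)) : MeasurableSet (polyhedron l) :=
  (isOpen_polyhedron l).measurableSet

variable [FiniteDimensional ℝ E]

theorem volume_hyperplane {v : E} (hv : v ≠ 0) (d : ℝ) :
    volume {x : E | inner ℝ v x = d} = 0 := by
  have h0 : inner ℝ v v ≠ 0 := inner_self_ne_zero.2 hv
  let p : E := (d / inner ℝ v v) • v
  have hp : inner ℝ v p = d := by simp only [p, inner_smul_right]; field_simp
  have h := Measure.addHaar_affineSubspace volume (AffineSubspace.mk' p (ℝ ∙ v)ᗮ) (by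
    intro htop
    have : p + v ∈ AffineSubspace.mk' p (ℝ ∙ v)ᗮ := by rw [htop]; trivial
    rw [AffineSubspace.mem_mk', vsub_eq_sub, add_sub_cancel_left,
      Submodule.mem_orthogonal_singleton_iff_inner_right] at this
    exact h0 this)
  convert h using 2
  ext x
  simp only [Set.mem_ofPred_eq, SetLike.mem_coe, AffineSubspace.mem_mk', vsub_eq_sub,
    Submodule.mem_orthogonal_singleton_iff_inner_right, inner_sub_right, hp, sub_eq_zero]

/-- Generic points of the hyperplane `⟪v, x⟫ = d` avoid every other hyperplane of the list. -/
theorem ae_inner_ne {v : E} (hv : ‖v‖ = 1) (d : ℝ) (l : List (E × ℝ))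
    (hl : ∀ p ∈ l, p.1 ≠ 0 → ∀ c : ℝ, p ≠ (c • v, c * d)) :
    ∀ᵐ z : (ℝ ∙ v)ᗮ, ∀ p ∈ l, p.1 ≠ 0 → inner ℝ p.1 (d • v + (z : E)) ≠ p.2 := by
  have : ∀ p ∈ l, ∀ᵐ z : (ℝ ∙ v)ᗮ, p.1 ≠ 0 → inner ℝ p.1 (d • v + (z : E)) ≠ p.2 := by
    intro p hp
    by_cases h0 : p.1 = 0
    · exact .of_forall fun z h => absurd h0 h
    set w : (ℝ ∙ v)ᗮ := (ℝ ∙ v)ᗮ.orthogonalProjectionOnto p.1 with hw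
    have hin : ∀ z : (ℝ ∙ v)ᗮ, inner ℝ p.1 (d • v + (z : E)) = d * inner ℝ p.1 v + inner ℝ w z := by
      intro z
      rw [inner_add_right, inner_smul_right, hw,
        Submodule.inner_orthogonalProjectionOnto_eq_of_mem_right]
    by_cases hw0 : w = 0
    · refine .of_forall fun z _ hz => ?_
      rw [hin, hw0, inner_zero_left, add_zero] at hz
      rw [hw, Submodule.orthogonalProjectionOnto_eq_zero_iff, Submodule.orthogonal_orthogonal,
        Submodule.mem_span_singleton] at hw0
      obtain ⟨c, hc⟩ := hw0
      refine hl p hp h0 c (Prod.ext hc.symm ?_)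
      rw [← hz, ← hc, inner_smul_left, real_inner_self_eq_norm_sq, hv]
      simp [mul_comm]
    · have := volume_hyperplane hw0 (p.2 - d * inner ℝ p.1 v)
      refine (measure_eq_zero_iff_ae_notMem.1 this).mono fun z hz _ h => hz ?_
      rw [hin] at h
      rw [Set.mem_ofPred_eq]; linarith
  exact (ae_ball_iff (S := {p | p ∈ l}) l.finite_toSet.countable).2 this

end Faces

section Cutoff

/-- The cut-offs `smoothTransition (t / δ)` converge to the indicator of the positive axis. -/
theorem tendsto_smoothTransition_div (t : ℝ) :
    Tendsto (fun δ : ℝ => Real.smoothTransition (t / δ)) (nhdsWithin 0 (Set.Ioi 0))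
      (nhds ((Set.Ioi (0:ℝ)).indicator (fun _ => 1) t)) := by
  refine tendsto_const_nhds.congr' ?_
  rcases le_or_gt t 0 with ht | ht
  · filter_upwards [self_mem_nhdsWithin] with δ hδ
    rw [Set.indicator_of_notMem (by simpa using ht),
      Real.smoothTransition.zero_of_nonpos (div_nonpos_of_nonpos_of_nonneg ht (le_of_lt hδ))]
  · filter_upwards [self_mem_nhdsWithin, nhdsWithin_le_nhds (gt_mem_nhds ht)] with δ hδ h
    rw [Set.indicator_of_mem (by simpa using ht),
      Real.smoothTransition.one_of_one_le ((one_le_div hδ).2 (le_of_lt h))]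

variable {E : Type} [NormedAddCommGroup E] [InnerProductSpace ℝ E] [MeasurableSpace E]
  [BorelSpace E]

theorem measurableSet_face (v : E) (d : ℝ) (l : List (E × ℝ)) :
    MeasurableSet {z : (ℝ ∙ v)ᗮ | d • v + (z : E) ∈ polyhedron l} :=
  ((isOpen_polyhedron l).preimage (by fun_prop)).measurableSet

variable [FiniteDimensional ℝ E] {R : ℝ} {φ ψ : E → ℂ}

theorem IsRadialPair.mul_cutoff (h : IsRadialPair R φ ψ) (v : E) (d δ : ℝ) :
    IsRadialPair R (fun x => φ x * Real.smoothTransition ((inner ℝ v x - d) / δ))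
      (fun x => ψ x * Real.smoothTransition ((inner ℝ v x - d) / δ)
        + φ x * (deriv Real.smoothTransition ((inner ℝ v x - d) / δ) * (inner ℝ v x / δ) : ℝ)) := by
  have hχ : Continuous Real.smoothTransition := Real.smoothTransition.continuous
  have hd : Differentiable ℝ Real.smoothTransition :=
    (Real.smoothTransition.contDiff (n := 1)).differentiable (by simp)
  have hc : Continuous (deriv Real.smoothTransition) :=
    (Real.smoothTransition.contDiff (n := 1)).continuous_deriv le_rfl
  have hφ := h.continuous
  have hcont2 : Continuous fun x : E => φ x *
      (deriv Real.smoothTransition ((inner ℝ v x - d) / δ) * (inner ℝ v x / δ) : ℝ) := by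
    fun_prop
  refine ⟨by fun_prop, fun x hx => by rw [h.eq_zero x hx, zero_mul], ?_, ?_, ?_⟩
  · refine StronglyMeasurable.add (h.stronglyMeasurable.mul ?_) ?_
    · exact Continuous.stronglyMeasurable (by fun_prop)
    · exact hcont2.stronglyMeasurable
  · refine Integrable.add ?_ ?_
    · refine Integrable.mul_bdd (c := 1) h.integrable ?_ (.of_forall fun x => ?_)
      · exact Continuous.aestronglyMeasurable (by fun_prop)
      · rw [Complex.norm_real, Real.norm_of_nonneg (Real.smoothTransition.nonneg _)]
        exact Real.smoothTransition.le_one _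
    · exact hcont2.integrable_of_hasCompactSupport h.hasCompactSupport.mul_right
  · intro x hx
    have h1 := h.hasDerivAt x hx
    have h2 : HasDerivAt (fun t : ℝ => (inner ℝ v (t • x) - d) / δ) (inner ℝ v x / δ) 1 := by
      simp only [inner_smul_right]
      exact (((hasDerivAt_id (1:ℝ)).mul_const _).sub_const d).div_const δ |>.congr_deriv (by simp)
    have h3 := ((hd _).hasDerivAt.comp (1:ℝ) h2).ofReal_comp
    refine (h1.mul h3).congr_deriv ?_
    simp

/-- The contribution of the face `⟪v, x⟫ = d`, cut out by the remaining inequalities. -/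
noncomputable def faceTerm (φ : E → ℂ) (F : E × ℝ × List (E × ℝ)) : ℂ :=
  (F.2.1 : ℂ) * ∫ z : (ℝ ∙ F.1)ᗮ in {z : (ℝ ∙ F.1)ᗮ | F.2.1 • F.1 + (z : E) ∈ polyhedron F.2.2},
    φ (F.2.1 • F.1 + (z : E))

theorem IsRadialPair.eq_zero_of_le_norm (h : IsRadialPair R φ ψ) {v : E} (hv : ‖v‖ = 1) {a : ℝ}
    {z : (ℝ ∙ v)ᗮ} (hz : R ≤ ‖z‖) : φ (a • v + (z : E)) = 0 := by
  refine h.eq_zero _ (hz.trans ?_)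
  refine le_of_sq_le_sq ?_ (norm_nonneg _)
  rw [norm_sq_smul_add_orthogonal hv]
  nlinarith

theorem IsRadialPair.integrable_face (h : IsRadialPair R φ ψ) {v : E} (hv : ‖v‖ = 1) (d : ℝ) :
    Integrable fun z : (ℝ ∙ v)ᗮ => φ (d • v + (z : E)) := by
  have hc := h.continuous
  refine Continuous.integrable_of_hasCompactSupport (by fun_prop) ?_
  refine HasCompactSupport.of_support_subset_isCompact (isCompact_closedBall 0 R) ?_
  intro z hz
  rw [mem_closedBall_zero_iff]
  by_contra hz'
  exact hz (h.eq_zero_of_le_norm hv (not_le.1 hz').le)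

theorem tendsto_faceTerm (h : IsRadialPair R φ ψ) (v : E) (d : ℝ) {F : E × ℝ × List (E × ℝ)}
    (hF : ‖F.1‖ = 1) :
    Tendsto (fun δ : ℝ =>
        faceTerm (fun x => φ x * Real.smoothTransition ((inner ℝ v x - d) / δ)) F)
      (nhdsWithin 0 (Set.Ioi 0)) (nhds (faceTerm φ (F.1, F.2.1, (v, d) :: F.2.2))) := by
  obtain ⟨u, e, l⟩ := F
  simp only [faceTerm] at hF ⊢
  refine Tendsto.const_mul _ ?_
  have hset : {z : (ℝ ∙ u)ᗮ | e • u + (z : E) ∈ polyhedron ((v, d) :: l)}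
      = {z : (ℝ ∙ u)ᗮ | e • u + (z : E) ∈ polyhedron l} ∩
        {z : (ℝ ∙ u)ᗮ | d < inner ℝ v (e • u + (z : E))} := by
    ext z; simp [polyhedron, and_comm]
  have hmeas : MeasurableSet {z : (ℝ ∙ u)ᗮ | d < inner ℝ v (e • u + (z : E))} :=
    (isOpen_lt (by fun_prop) (by fun_prop)).measurableSet
  rw [hset, ← setIntegral_indicator hmeas]
  have hφ := h.continuous
  have hχ : Continuous Real.smoothTransition := Real.smoothTransition.continuous
  refine tendsto_integral_filter_of_dominated_convergence
    (fun z => ‖φ (e • u + (z : E))‖) ?_ ?_ (h.integrable_face hF e).norm.integrableOn ?_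
  · exact .of_forall fun δ => Continuous.aestronglyMeasurable (by fun_prop)
  · refine .of_forall fun δ => .of_forall fun z => ?_
    rw [norm_mul, Complex.norm_real, Real.norm_of_nonneg (Real.smoothTransition.nonneg _)]
    exact mul_le_of_le_one_right (norm_nonneg _) (Real.smoothTransition.le_one _)
  · refine .of_forall fun z => ?_
    have := (tendsto_smoothTransition_div (inner ℝ v (e • u + (z : E)) - d)).ofReal
    have := this.const_mul (φ (e • u + (z : E)))
    convert this using 2
    by_cases hz : d < inner ℝ v (e • u + (z : E)) <;> simp [Set.indicator, hz]

theorem tendsto_newFace (h : IsRadialPair R φ ψ) {v : E} (hv : ‖v‖ = 1) (d : ℝ)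
    (l : List (E × ℝ)) (hl : ∀ p ∈ l, p.1 ≠ 0 → ∀ c : ℝ, p ≠ (c • v, c * d)) :
    Tendsto (fun δ : ℝ => ∫ x in polyhedron l, φ x *
        (deriv Real.smoothTransition ((inner ℝ v x - d) / δ) * (inner ℝ v x / δ) : ℝ))
      (nhdsWithin 0 (Set.Ioi 0)) (nhds (faceTerm φ (v, d, l))) := by
  obtain ⟨C, hC0, hC⟩ := exists_smoothTransition_deriv_bound
  have hφ := h.continuous
  have hc : Continuous (deriv Real.smoothTransition) :=
    (Real.smoothTransition.contDiff (n := 1)).continuous_deriv le_rfl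
  set H : E → ℂ := (polyhedron l).indicator φ with hH
  have hHm : StronglyMeasurable H := hφ.stronglyMeasurable.indicator (measurableSet_polyhedron l)
  have hcov : ∀ δ : ℝ, 0 < δ → ∫ x in polyhedron l, φ x *
        (deriv Real.smoothTransition ((inner ℝ v x - d) / δ) * (inner ℝ v x / δ) : ℝ)
      = ∫ p : ℝ × (ℝ ∙ v)ᗮ, H ((d + δ * p.1) • v + (p.2 : E)) *
        (deriv Real.smoothTransition p.1 * (d + δ * p.1) : ℝ) := by
    intro δ hδ
    rw [← integral_indicator (measurableSet_polyhedron l),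
      ← (measurePreserving_smul_add_orthogonal hv).integral_comp
        (measurableEmbedding_smul_add_orthogonal hv),
      integral_prod_comp_affine _ d hδ, ← integral_const_mul]
    congr 1
    ext p
    simp only
    by_cases hp : (d + δ * p.1) • v + (p.2 : E) ∈ polyhedron l
    · rw [Set.indicator_of_mem hp, hH, Set.indicator_of_mem hp, inner_add_smul_orthogonal hv,
        add_sub_cancel_left, mul_div_cancel_left₀ _ hδ.ne']
      have : (δ : ℂ) ≠ 0 := by exact_mod_cast hδ.ne'
      push_cast
      field_simp
    · rw [Set.indicator_of_notMem hp, hH, Set.indicator_of_notMem hp]; simp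
  have hlim : faceTerm φ (v, d, l) = ∫ p : ℝ × (ℝ ∙ v)ᗮ, 
      (deriv Real.smoothTransition p.1 * d : ℝ) * H (d • v + (p.2 : E)) := by
    rw [Measure.volume_eq_prod, integral_prod_mul (fun t : ℝ => ((deriv Real.smoothTransition t * d : ℝ) : ℂ))
      (fun z : (ℝ ∙ v)ᗮ => H (d • v + (z : E))), integral_complex_ofReal, integral_mul_const,
      integral_deriv_smoothTransition, one_mul, faceTerm,
      ← integral_indicator (measurableSet_face v d l)]
    rfl
  rw [hlim]
  refine Tendsto.congr' (f₁ := fun δ : ℝ => ∫ p : ℝ × (ℝ ∙ v)ᗮ, H ((d + δ * p.1) • v + (p.2 : E)) *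
        (deriv Real.smoothTransition p.1 * (d + δ * p.1) : ℝ)) ?_ ?_
  · filter_upwards [self_mem_nhdsWithin] with δ hδ using (hcov δ hδ).symm
  obtain ⟨M, hM⟩ : ∃ M, ∀ x, ‖φ x‖ ≤ M := hφ.bounded_above_of_compact_support h.hasCompactSupport
  have hM0 : 0 ≤ M := (norm_nonneg _).trans (hM 0)
  have hHM : ∀ x, ‖H x‖ ≤ M := fun x =>
    (norm_indicator_le_norm_self _ _).trans (hM x)
  refine tendsto_integral_filter_of_dominated_convergence
    ((Set.Icc (0:ℝ) 1 ×ˢ closedBall (0 : (ℝ ∙ v)ᗮ) R).indicator fun _ => M * (C * (|d| + 1))) ?_ ?_ ?_ ?_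
  · refine .of_forall fun δ => ?_
    refine ((hHm.comp_measurable ?_).mul ?_).aestronglyMeasurable
    · exact Continuous.measurable (by fun_prop)
    · exact Continuous.stronglyMeasurable (by fun_prop)
  · have : ∀ᶠ δ : ℝ in nhdsWithin 0 (Set.Ioi 0), δ < 1 := nhdsWithin_le_nhds (gt_mem_nhds one_pos)
    filter_upwards [self_mem_nhdsWithin, this] with δ hδ hδ1
    have hδ0 : 0 < δ := hδ
    refine .of_forall fun p => ?_
    by_cases hp : p ∈ Set.Icc (0:ℝ) 1 ×ˢ closedBall (0 : (ℝ ∙ v)ᗮ) R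
    · rw [Set.indicator_of_mem hp, norm_mul, Complex.norm_real, norm_mul]
      have h1 := hC p.1
      rw [Set.indicator_of_mem hp.1] at h1
      have h2 : |d + δ * p.1| ≤ |d| + 1 := by
        refine (abs_add_le _ _).trans (add_le_add le_rfl ?_)
        have := hp.1
        rw [abs_of_nonneg (mul_nonneg hδ0.le this.1)]
        nlinarith [this.1, this.2]
      exact mul_le_mul (hHM _) (mul_le_mul h1 h2 (abs_nonneg _) hC0) (by positivity) hM0
    · rw [Set.indicator_of_notMem hp]
      rw [Set.mem_prod, not_and_or] at hp
      rcases hp with hp | hp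
      · have h1 := hC p.1
        rw [Set.indicator_of_notMem hp] at h1
        rw [abs_nonpos_iff.1 h1]; simp
      · have : H ((d + δ * p.1) • v + (p.2 : E)) = 0 := by
          have h0 := h.eq_zero_of_le_norm hv (a := d + δ * p.1) (z := p.2)
            (by rw [mem_closedBall_zero_iff, not_le] at hp; exact hp.le)
          simp [hH, Set.indicator, h0]
        rw [this]; simp
  · rw [integrable_indicator_iff (measurableSet_Icc.prod measurableSet_closedBall)]
    exact integrableOn_const (hs := (isCompact_Icc.prod (isCompact_closedBall _ _)).measure_lt_top.ne)
  · have hae : ∀ᵐ p : ℝ × (ℝ ∙ v)ᗮ, ∀ q ∈ l, q.1 ≠ 0 → inner ℝ q.1 (d • v + (p.2 : E)) ≠ q.2 :=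
      Measure.quasiMeasurePreserving_snd.ae (ae_inner_ne hv d l hl)
    filter_upwards [hae] with p hp
    have hcont : Tendsto (fun δ : ℝ => (d + δ * p.1) • v + (p.2 : E)) (nhdsWithin 0 (Set.Ioi 0))
        (nhds (d • v + (p.2 : E))) := by
      have : Continuous fun δ : ℝ => (d + δ * p.1) • v + (p.2 : E) := by fun_prop
      have := this.tendsto 0
      simp only [zero_mul, add_zero] at this
      exact this.mono_left nhdsWithin_le_nhds
    have hHc : Tendsto H (nhds (d • v + (p.2 : E))) (nhds (H (d • v + (p.2 : E)))) := by
      by_cases hmem : d • v + (p.2 : E) ∈ polyhedron l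
      · rw [hH, Set.indicator_of_mem hmem]
        refine (hφ.tendsto _).congr' ?_
        filter_upwards [eventually_mem_polyhedron_iff l hp] with y hy
        rw [Set.indicator_of_mem (hy.2 hmem)]
      · rw [hH, Set.indicator_of_notMem hmem]
        refine tendsto_const_nhds.congr' ?_
        filter_upwards [eventually_mem_polyhedron_iff l hp] with y hy
        rw [Set.indicator_of_notMem (fun h => hmem (hy.1 h))]
    have h2 : Tendsto (fun δ : ℝ => ((deriv Real.smoothTransition p.1 * (d + δ * p.1) : ℝ) : ℂ))
        (nhdsWithin 0 (Set.Ioi 0)) (nhds ((deriv Real.smoothTransition p.1 * d : ℝ) : ℂ)) := by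
      have : Continuous fun δ : ℝ => ((deriv Real.smoothTransition p.1 * (d + δ * p.1) : ℝ) : ℂ) := by
        fun_prop
      have := this.tendsto 0
      simp only [zero_mul, add_zero] at this
      exact this.mono_left nhdsWithin_le_nhds
    rw [mul_comm]
    exact (hHc.comp hcont).mul h2

end Cutoff

section DivergenceFormula

variable {E : Type} [NormedAddCommGroup E] [InnerProductSpace ℝ E]

theorem polyhedron_cons (v : E) (d : ℝ) (l : List (E × ℝ)) :
    polyhedron ((v, d) :: l) = polyhedron l ∩ {x | d < inner ℝ v x} := by
  ext x; simp [polyhedron, and_comm]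

theorem polyhedron_cons_smul {c : ℝ} (hc : 0 < c) (v : E) (d : ℝ) (l : List (E × ℝ)) :
    polyhedron ((c • v, c * d) :: l) = polyhedron ((v, d) :: l) := by
  ext x
  simp [polyhedron, inner_smul_left, hc]

variable [MeasurableSpace E] [BorelSpace E] [FiniteDimensional ℝ E]

/-- `faces` computes the integrals of radial divergences over `K`. -/
def HasFaces (K : Set E) (faces : List (E × ℝ × List (E × ℝ))) : Prop :=
  (∀ F ∈ faces, ‖F.1‖ = 1) ∧ ∀ (R : ℝ) (φ ψ : E → ℂ), 0 < R → IsRadialPair R φ ψ →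
    ∫ x in K, ((Module.finrank ℝ E : ℂ) * φ x + ψ x) = -(faces.map (faceTerm φ)).sum

theorem hasFaces_univ : HasFaces (Set.univ : Set E) [] :=
  ⟨by simp, fun R φ ψ hR h => by simpa using h.integral_eq_zero hR⟩

theorem hasFaces_empty : HasFaces (∅ : Set E) [] :=
  ⟨by simp, fun R φ ψ hR h => by simp⟩

theorem HasFaces.cons {l : List (E × ℝ)} {faces : List (E × ℝ × List (E × ℝ))}
    (h : HasFaces (polyhedron l) faces) {v : E} (hv : ‖v‖ = 1) (d : ℝ)
    (hl : ∀ p ∈ l, p.1 ≠ 0 → ∀ c : ℝ, p ≠ (c • v, c * d)) :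
    HasFaces (polyhedron ((v, d) :: l))
      ((v, d, l) :: faces.map fun F => (F.1, F.2.1, (v, d) :: F.2.2)) := by
  refine ⟨fun F hF => ?_, fun R φ ψ hR hp => ?_⟩
  · rw [List.mem_cons, List.mem_map] at hF
    obtain rfl | ⟨G, hG, rfl⟩ := hF
    · exact hv
    · exact h.1 G hG
  set k : ℂ := (Module.finrank ℝ E : ℂ)
  have hφ := hp.continuous
  have hχ : Continuous Real.smoothTransition := Real.smoothTransition.continuous
  have hc : Continuous (deriv Real.smoothTransition) :=
    (Real.smoothTransition.contDiff (n := 1)).continuous_deriv le_rfl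
  have hgi : Integrable fun x => k * φ x + ψ x := (hp.integrable_left.const_mul _).add hp.integrable
  have hgχ : ∀ δ : ℝ, Integrable fun x =>
      (k * φ x + ψ x) * Real.smoothTransition ((inner ℝ v x - d) / δ) := fun δ => by
    refine Integrable.mul_bdd (c := 1) hgi ?_ (.of_forall fun x => ?_)
    · exact Continuous.aestronglyMeasurable (by fun_prop)
    · rw [Complex.norm_real, Real.norm_of_nonneg (Real.smoothTransition.nonneg _)]
      exact Real.smoothTransition.le_one _
  have hni : ∀ δ : ℝ, Integrable fun x : E => φ x *
      (deriv Real.smoothTransition ((inner ℝ v x - d) / δ) * (inner ℝ v x / δ) : ℝ) := fun δ =>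
    Continuous.integrable_of_hasCompactSupport (by fun_prop) hp.hasCompactSupport.mul_right
  have hmain : Tendsto (fun δ : ℝ => ∫ x in polyhedron l,
      (k * φ x + ψ x) * Real.smoothTransition ((inner ℝ v x - d) / δ)) (nhdsWithin 0 (Set.Ioi 0))
      (nhds (∫ x in polyhedron ((v, d) :: l), (k * φ x + ψ x))) := by
    have hmeas : MeasurableSet {x : E | d < inner ℝ v x} :=
      (isOpen_lt (by fun_prop) (by fun_prop)).measurableSet
    rw [polyhedron_cons, ← setIntegral_indicator hmeas]
    refine tendsto_integral_filter_of_dominated_convergence (fun x => ‖k * φ x + ψ x‖) ?_ ?_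
      hgi.norm.integrableOn ?_
    · exact .of_forall fun δ => (hgχ δ).aestronglyMeasurable.restrict
    · refine .of_forall fun δ => .of_forall fun z => ?_
      rw [norm_mul, Complex.norm_real, Real.norm_of_nonneg (Real.smoothTransition.nonneg _)]
      exact mul_le_of_le_one_right (norm_nonneg _) (Real.smoothTransition.le_one _)
    · refine .of_forall fun x => ?_
      have := ((tendsto_smoothTransition_div (inner ℝ v x - d)).ofReal).const_mul (k * φ x + ψ x)
      convert this using 2
      by_cases hz : d < inner ℝ v x <;> simp [Set.indicator, hz]
  have hnew := tendsto_newFace hp hv d l hl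
  have hold : Tendsto (fun δ : ℝ => (faces.map (faceTerm fun x =>
        φ x * Real.smoothTransition ((inner ℝ v x - d) / δ))).sum) (nhdsWithin 0 (Set.Ioi 0))
      (nhds (faces.map fun F => faceTerm φ (F.1, F.2.1, (v, d) :: F.2.2)).sum) :=
    tendsto_list_sum faces fun F hF => tendsto_faceTerm hp v d (h.1 F hF)
  have hrel : ∀ δ : ℝ, (∫ x in polyhedron l,
        (k * φ x + ψ x) * Real.smoothTransition ((inner ℝ v x - d) / δ))
      + ∫ x in polyhedron l, φ x *
        (deriv Real.smoothTransition ((inner ℝ v x - d) / δ) * (inner ℝ v x / δ) : ℝ)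
      = -(faces.map (faceTerm fun x =>
        φ x * Real.smoothTransition ((inner ℝ v x - d) / δ))).sum := fun δ => by
    rw [← h.2 R _ _ hR (hp.mul_cutoff v d δ), ← integral_add (hgχ δ).integrableOn (hni δ).integrableOn]
    congr 1
    ext x
    ring
  have hl1 := hmain.add hnew
  simp only [hrel] at hl1
  have := tendsto_nhds_unique hl1 hold.neg
  rw [List.map_cons, List.sum_cons, List.map_map]
  exact eq_sub_of_add_eq this |>.trans (by rw [neg_add_rev]; rfl)

/-- The radial divergence formula: for every polyhedron, the integral of the radial divergence is
a combination of integrals over the faces. -/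
theorem exists_hasFaces (l : List (E × ℝ)) : ∃ faces, HasFaces (polyhedron l) faces := by
  induction l with
  | nil => exact ⟨[], by simpa [polyhedron] using hasFaces_univ⟩
  | cons q l ih =>
    obtain ⟨w, e⟩ := q
    obtain ⟨faces, hf⟩ := ih
    by_cases hw : w = 0
    · by_cases he : e < 0
      · refine ⟨faces, ?_⟩
        have : polyhedron ((w, e) :: l) = polyhedron l := by
          rw [polyhedron_cons]; simp [hw, he]
        rwa [this]
      · refine ⟨[], ?_⟩
        have : polyhedron ((w, e) :: l) = ∅ := by
          rw [polyhedron_cons]; simp [hw, he]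
        rw [this]; exact hasFaces_empty
    have hw0 : 0 < ‖w‖ := norm_pos_iff.2 hw
    set v := ‖w‖⁻¹ • w with hvdef
    set d := ‖w‖⁻¹ * e with hd
    have hv : ‖v‖ = 1 := by rw [hvdef, norm_smul, norm_inv, norm_norm, inv_mul_cancel₀ hw0.ne']
    rw [← polyhedron_cons_smul (inv_pos.2 hw0)]
    by_cases hl : ∀ p ∈ l, p.1 ≠ 0 → ∀ c : ℝ, p ≠ (c • v, c * d)
    · exact ⟨_, hf.cons hv d hl⟩
    push Not at hl
    obtain ⟨p, hpl, hp0, c, rfl⟩ := hl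
    have hc : c ≠ 0 := by rintro rfl; simp at hp0
    rcases lt_or_gt_of_ne hc with hc | hc
    · refine ⟨[], ?_⟩
      have : polyhedron ((v, d) :: l) = ∅ := by
        rw [polyhedron_cons, Set.eq_empty_iff_forall_notMem]
        rintro x ⟨hx, hx'⟩
        have h1 := hx _ hpl
        rw [inner_smul_left] at h1
        simp only [conj_trivial] at h1
        exact absurd hx' (not_lt.2 (le_of_lt ((mul_lt_mul_left_of_neg hc).1 h1)))
      rw [this]; exact hasFaces_empty
    · refine ⟨faces, ?_⟩
      have : polyhedron ((v, d) :: l) = polyhedron l := by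
        rw [polyhedron_cons, Set.inter_eq_left]
        intro x hx
        have h1 := hx _ hpl
        rw [inner_smul_left] at h1
        simp only [conj_trivial] at h1
        exact (mul_lt_mul_iff_right₀ hc).1 h1
      rwa [this]

end DivergenceFormula

section Sheets

variable {E : Type} [NormedAddCommGroup E]

/-- The height of the upper half of the sphere of radius `R` over the point `x`. -/
noncomputable def height (R : ℝ) (x : E) : ℝ := √(R ^ 2 - ‖x‖ ^ 2)

/-- The density at `x`, up to the factor `R`, of the pushforward to the equatorial plane of the
surface measure on the sphere of radius `R`, weighted by `F`. -/
noncomputable def sheets (R : ℝ) (F : E × ℝ → ℂ) (x : E) : ℂ :=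
  (height R x : ℂ)⁻¹ * (F (x, height R x) + F (x, -height R x))

theorem continuous_height (R : ℝ) : Continuous (height R : E → ℝ) := by
  unfold height; fun_prop

theorem height_nonneg (R : ℝ) (x : E) : 0 ≤ height R x := Real.sqrt_nonneg _

theorem height_eq_zero {R : ℝ} (hR : 0 ≤ R) {x : E} (hx : R ≤ ‖x‖) : height R x = 0 :=
  Real.sqrt_eq_zero_of_nonpos (by nlinarith)

theorem height_le {R : ℝ} (hR : 0 ≤ R) (x : E) : height R x ≤ R := by
  refine Real.sqrt_le_iff.2 ⟨hR, ?_⟩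
  nlinarith [sq_nonneg ‖x‖]

theorem height_pos {R : ℝ} {x : E} (hx : ‖x‖ < R) : 0 < height R x :=
  Real.sqrt_pos.2 (by nlinarith [norm_nonneg x])

theorem sq_height {R : ℝ} {x : E} (hx : ‖x‖ < R) : height R x ^ 2 = R ^ 2 - ‖x‖ ^ 2 :=
  Real.sq_sqrt (by nlinarith [norm_nonneg x])

theorem sheets_eq_zero {R : ℝ} (hR : 0 ≤ R) {x : E} (hx : R ≤ ‖x‖) (F : E × ℝ → ℂ) :
    sheets R F x = 0 := by
  simp [sheets, height_eq_zero hR hx]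

theorem sheets_congr {R : ℝ} (hR : 0 ≤ R) {F G : E × ℝ → ℂ}
    (h : ∀ x : E, ∀ σ : ℝ, ‖x‖ < R → σ ≠ 0 → σ ^ 2 = R ^ 2 - ‖x‖ ^ 2 → F (x, σ) = G (x, σ)) :
    sheets R F = sheets R G := by
  ext x
  rcases le_or_gt R ‖x‖ with hx | hx
  · rw [sheets_eq_zero hR hx, sheets_eq_zero hR hx]
  · have h0 := (height_pos hx).ne'
    rw [sheets, sheets, h x _ hx h0 (sq_height hx),
      h x _ hx (neg_ne_zero.2 h0) (by rw [neg_sq, sq_height hx])]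

theorem sheets_add (R : ℝ) (F G : E × ℝ → ℂ) (x : E) :
    sheets R (fun p => F p + G p) x = sheets R F x + sheets R G x := by
  simp only [sheets]; ring

theorem sheets_const_mul (R : ℝ) (a : ℂ) (F : E × ℝ → ℂ) (x : E) :
    sheets R (fun p => a * F p) x = a * sheets R F x := by
  simp only [sheets]; ring

theorem sheets_snd_mul (R : ℝ) (F : E × ℝ → ℂ) (x : E) :
    sheets R (fun p => (p.2 : ℂ) * F p) x = F (x, height R x) - F (x, -height R x) := by
  simp only [sheets]
  by_cases h : height R x = 0
  · simp [h]
  · have : (height R x : ℂ) ≠ 0 := by exact_mod_cast h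
    push_cast
    field_simp
    ring

/-- Functions on the ball with the singularity of `|σ| ^ (-1/2)` on the equator. -/
theorem norm_sheets_le {R : ℝ} (hR : 0 ≤ R) {F : E × ℝ → ℂ} {C : ℝ} {x : E}
    (hF : ∀ σ : ℝ, ‖x‖ ≤ R → σ ≠ 0 → |σ| ≤ R → ‖F (x, σ)‖ ≤ C * |σ| ^ (-(1 / 2) : ℝ)) :
    ‖sheets R F x‖ ≤ 2 * C * height R x ^ (-(3 / 2) : ℝ) := by
  rcases le_or_gt R ‖x‖ with hx | hx
  · rw [sheets_eq_zero hR hx, height_eq_zero hR hx, Real.zero_rpow (by norm_num)]; simp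
  have h0 := height_pos hx
  have h1 := hF (height R x) hx.le h0.ne' (by rw [abs_of_pos h0]; exact height_le hR x)
  have h2 := hF (-height R x) hx.le (neg_ne_zero.2 h0.ne')
    (by rw [abs_neg, abs_of_pos h0]; exact height_le hR x)
  rw [abs_of_pos h0] at h1
  rw [abs_neg, abs_of_pos h0] at h2
  have h3 : height R x ^ (-(3 / 2) : ℝ) = (height R x)⁻¹ * height R x ^ (-(1 / 2) : ℝ) := by
    rw [← Real.rpow_neg_one, ← Real.rpow_add h0]; norm_num
  rw [sheets, norm_mul, norm_inv, Complex.norm_real, Real.norm_of_nonneg h0.le, h3]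
  calc _ ≤ (height R x)⁻¹ * (C * height R x ^ (-(1 / 2) : ℝ) + C * height R x ^ (-(1 / 2) : ℝ)) := by
        gcongr
        exact (norm_add_le _ _).trans (add_le_add h1 h2)
    _ = _ := by ring

theorem exists_bound_of_continuous [ProperSpace E] {F : E × ℝ → ℂ} (hF : Continuous F) (R : ℝ) :
    ∃ M, 0 ≤ M ∧ ∀ x : E, ∀ σ : ℝ, ‖x‖ ≤ R → |σ| ≤ R → ‖F (x, σ)‖ ≤ M := by
  obtain ⟨M, hM⟩ := ((isCompact_closedBall (0 : E) R).prod
    (isCompact_Icc (a := -R) (b := R))).exists_bound_of_continuousOn hF.continuousOn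
  refine ⟨|M|, abs_nonneg _, fun x σ hx hσ => (hM (x, σ) ⟨by simpa using hx, abs_le.1 hσ⟩).trans
    (le_abs_self _)⟩

theorem one_le_mul_rpow_neg_half {R σ : ℝ} (hσ : σ ≠ 0) (h : |σ| ≤ R) :
    1 ≤ √R * |σ| ^ (-(1 / 2) : ℝ) := by
  have h0 : 0 < |σ| := abs_pos.2 hσ
  rw [Real.rpow_neg h0.le, ← Real.sqrt_eq_rpow, ← div_eq_mul_inv, one_le_div (Real.sqrt_pos.2 h0)]
  exact Real.sqrt_le_sqrt h

variable [InnerProductSpace ℝ E] [MeasurableSpace E] [BorelSpace E]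

theorem measurable_sheets {R : ℝ} {F : E × ℝ → ℂ} [FiniteDimensional ℝ E] (hF : Measurable F) :
    Measurable (sheets R F) := by
  have h := (continuous_height (E := E) R).measurable
  have h1 : Measurable fun x : E => (x, height R x) := measurable_id.prodMk h
  have h2 : Measurable fun x : E => (x, -height R x) := measurable_id.prodMk h.neg
  have h3 : Measurable fun x : E => (height R x : ℂ)⁻¹ := by fun_prop
  exact h3.mul ((hF.comp h1).add (hF.comp h2))

theorem integrableOn_height_rpow_Ioo {R : ℝ} (hR : 0 < R) :
    IntegrableOn (fun y : ℝ => √(R ^ 2 - y ^ 2) ^ (-(3 / 2) : ℝ)) (Set.Ioo 0 R) := by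
  have h1 : IntervalIntegrable (fun y : ℝ => (R - y) ^ (-(3 / 4) : ℝ)) volume 0 R := by
    have := (intervalIntegral.intervalIntegrable_rpow' (a := 0) (b := R)
      (r := (-(3 / 4) : ℝ)) (by norm_num)).comp_sub_left R
    simpa using this.symm
  rw [intervalIntegrable_iff_integrableOn_Ioo_of_le hR.le] at h1
  refine Integrable.mono' (h1.const_mul (R ^ (-(3 / 4) : ℝ))) ?_ ?_
  · exact Measurable.aestronglyMeasurable (by fun_prop)
  · filter_upwards [ae_restrict_mem measurableSet_Ioo] with y hy
    have h0 : 0 < R - y := sub_pos.2 hy.2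
    have h2 : R * (R - y) ≤ R ^ 2 - y ^ 2 := by nlinarith [hy.1, hy.2]
    have h3 : 0 < R * (R - y) := by positivity
    rw [Real.norm_of_nonneg (Real.rpow_nonneg (Real.sqrt_nonneg _) _), Real.sqrt_eq_rpow,
      ← Real.rpow_mul (h3.le.trans h2), ← Real.mul_rpow hR.le h0.le]
    norm_num
    exact Real.rpow_le_rpow_of_nonpos h3 h2 (by norm_num)

theorem integrable_height_rpow [FiniteDimensional ℝ E] {R : ℝ} (hR : 0 < R) :
    Integrable fun x : E => height R x ^ (-(3 / 2) : ℝ) := by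
  rcases subsingleton_or_nontrivial E with hE | hE
  · have : IsFiniteMeasure (volume : Measure E) :=
      ⟨(measure_mono (fun x _ => mem_closedBall_zero_iff.2
        (by rw [Subsingleton.elim x 0, norm_zero]))).trans_lt (measure_closedBall_lt_top (x := (0 : E)) (r := 0))⟩
    have : (fun x : E => height R x ^ (-(3 / 2) : ℝ)) = fun _ => height R (0 : E) ^ (-(3 / 2) : ℝ) := by
      ext x; rw [Subsingleton.elim x 0]
    rw [this]; exact integrable_const _
  refine (integrable_fun_norm_addHaar (volume : Measure E)
    (f := fun y : ℝ => √(R ^ 2 - y ^ 2) ^ (-(3 / 2) : ℝ))).2 ?_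
  have h : IntegrableOn (fun y : ℝ => y ^ (Module.finrank ℝ E - 1) • √(R ^ 2 - y ^ 2) ^ (-(3 / 2) : ℝ))
      (Set.Ioo 0 R) := by
    refine Integrable.mono' ((integrableOn_height_rpow_Ioo hR).const_mul (R ^ (Module.finrank ℝ E - 1))) ?_ ?_
    · exact Measurable.aestronglyMeasurable (by fun_prop)
    · filter_upwards [ae_restrict_mem measurableSet_Ioo] with y hy
      rw [norm_smul, Real.norm_of_nonneg (pow_nonneg hy.1.le _),
        Real.norm_of_nonneg (Real.rpow_nonneg (Real.sqrt_nonneg _) _)]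
      gcongr
      · exact hy.1.le
      · exact hy.2.le
  refine h.of_forall_sdiff_eq_zero measurableSet_Ioi fun y hy => ?_
  have : R ≤ y := by
    by_contra hlt
    exact hy.2 ⟨hy.1, not_le.1 hlt⟩
  rw [Real.sqrt_eq_zero_of_nonpos (by nlinarith), Real.zero_rpow (by norm_num), smul_zero]

variable [FiniteDimensional ℝ E]

theorem integrable_sheets_of_bound {R : ℝ} (hR : 0 < R) {F : E × ℝ → ℂ} (hF : Measurable F) {C : ℝ}
    (hC : ∀ x : E, ∀ σ : ℝ, ‖x‖ ≤ R → σ ≠ 0 → |σ| ≤ R → ‖F (x, σ)‖ ≤ C * |σ| ^ (-(1 / 2) : ℝ)) :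
    Integrable (sheets R F) :=
  Integrable.mono' ((integrable_height_rpow hR).const_mul (2 * C))
    (measurable_sheets hF).aestronglyMeasurable (.of_forall fun x => norm_sheets_le hR.le (hC x))

theorem integrable_sheets {R : ℝ} (hR : 0 < R) {F : E × ℝ → ℂ} (hF : Continuous F) :
    Integrable (sheets R F) := by
  obtain ⟨M, hM0, hM⟩ := exists_bound_of_continuous hF R
  refine integrable_sheets_of_bound hR hF.measurable (C := M * √R) fun x σ hx h0 hσ => ?_
  rw [mul_assoc]
  exact (hM x σ hx hσ).trans (le_mul_of_one_le_right hM0 (one_le_mul_rpow_neg_half h0 hσ))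

theorem tendsto_integral_sheets {R : ℝ} (hR : 0 < R) (K : Set E) {F : ℝ → E × ℝ → ℂ} {G : E × ℝ → ℂ}
    (hF : ∀ ε, 0 < ε → Measurable (F ε)) {C : ℝ}
    (hC : ∀ ε, 0 < ε → ε < 1 → ∀ x : E, ∀ σ : ℝ, ‖x‖ ≤ R → σ ≠ 0 → |σ| ≤ R →
      ‖F ε (x, σ)‖ ≤ C * |σ| ^ (-(1 / 2) : ℝ))
    (hG : ∀ x : E, ∀ σ : ℝ, σ ≠ 0 →
      Tendsto (fun ε => F ε (x, σ)) (nhdsWithin 0 (Set.Ioi 0)) (nhds (G (x, σ)))) :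
    Tendsto (fun ε => ∫ x in K, sheets R (F ε) x) (nhdsWithin 0 (Set.Ioi 0))
      (nhds (∫ x in K, sheets R G x)) := by
  have h1 : ∀ᶠ ε : ℝ in nhdsWithin 0 (Set.Ioi 0), ε < 1 := nhdsWithin_le_nhds (gt_mem_nhds one_pos)
  refine tendsto_integral_filter_of_dominated_convergence
    (fun x => 2 * C * height R x ^ (-(3 / 2) : ℝ)) ?_ ?_
    ((integrable_height_rpow hR).const_mul (2 * C)).integrableOn ?_
  · filter_upwards [self_mem_nhdsWithin] with ε hε
    exact (measurable_sheets (hF ε hε)).aestronglyMeasurable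
  · filter_upwards [self_mem_nhdsWithin, h1] with ε hε hε1
    exact .of_forall fun x => norm_sheets_le hR.le (hC ε hε hε1 x)
  · refine .of_forall fun x => ?_
    rcases le_or_gt R ‖x‖ with hx | hx
    · simp only [sheets_eq_zero hR.le hx]; exact tendsto_const_nhds
    · have h0 := (height_pos hx).ne'
      exact ((hG x _ h0).add (hG x _ (neg_ne_zero.2 h0))).const_mul _

end Sheets

section SheetsDivergence

variable {E : Type} [NormedAddCommGroup E] [InnerProductSpace ℝ E]

/-- The derivative of `F` along the tangential part of `σ • x`, on the sphere. -/
noncomputable def tangential (F : E × ℝ → ℂ) (p : E × ℝ) : ℂ :=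
  p.2 * fderiv ℝ F p (p.1, 0) - (‖p.1‖ ^ 2 : ℝ) * fderiv ℝ F p (0, 1)

theorem hasDerivAt_height_smul {R : ℝ} {x : E} (hx : ‖x‖ < R) :
    HasDerivAt (fun t : ℝ => height R (t • x)) (-(‖x‖ ^ 2) / height R x) 1 := by
  have h1 : HasDerivAt (fun t : ℝ => R ^ 2 - ‖t • x‖ ^ 2) (-(2 * ‖x‖ ^ 2)) 1 := by
    have : (fun t : ℝ => R ^ 2 - ‖t • x‖ ^ 2) = fun t => R ^ 2 - t ^ 2 * ‖x‖ ^ 2 := by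
      ext t; rw [norm_smul, mul_pow, Real.norm_eq_abs, sq_abs]
    rw [this]
    exact (((hasDerivAt_pow 2 (1:ℝ)).mul_const (‖x‖ ^ 2)).const_sub _).congr_deriv (by simp)
  have h2 := h1.sqrt (by
    rw [one_smul]
    have := height_pos hx
    rw [← sq_height hx]; positivity)
  refine h2.congr_deriv ?_
  rw [one_smul]
  have h0 := (height_pos hx).ne'
  change -(2 * ‖x‖ ^ 2) / (2 * height R x) = _
  field_simp

theorem continuous_tangential {F : E × ℝ → ℂ} (hF : ContDiff ℝ 1 F) :
    Continuous (tangential F) := by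
  have h := hF.continuous_fderiv one_ne_zero
  have h1 : Continuous fun p : E × ℝ => fderiv ℝ F p (p.1, 0) := h.clm_apply (by fun_prop)
  have h2 : Continuous fun p : E × ℝ => fderiv ℝ F p (0, 1) := h.clm_apply (by fun_prop)
  unfold tangential
  fun_prop

/-- The restriction of a half-space to the hyperplane `⟪v, x⟫ = d`. -/
noncomputable def faceConstraints (v : E) (d : ℝ) (l : List (E × ℝ)) : List ((ℝ ∙ v)ᗮ × ℝ) :=
  l.map fun p => ((ℝ ∙ v)ᗮ.orthogonalProjectionOnto p.1, p.2 - d * inner ℝ p.1 v)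

theorem mem_polyhedron_faceConstraints (v : E) (d : ℝ) (l : List (E × ℝ)) (z : (ℝ ∙ v)ᗮ) :
    z ∈ polyhedron (faceConstraints v d l) ↔ d • v + (z : E) ∈ polyhedron l := by
  simp only [polyhedron, faceConstraints, List.mem_map, Set.mem_ofPred_eq, forall_exists_index,
    and_imp, forall_apply_eq_imp_iff₂, Submodule.inner_orthogonalProjectionOnto_eq_of_mem_right,
    inner_add_right, inner_smul_right, sub_lt_iff_lt_add']

theorem height_face {v : E} (hv : ‖v‖ = 1) (R d : ℝ) (z : (ℝ ∙ v)ᗮ) :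
    height R (d • v + (z : E)) = height (√(R ^ 2 - d ^ 2)) z := by
  rw [height, height, norm_sq_smul_add_orthogonal hv]
  rcases le_or_gt 0 (R ^ 2 - d ^ 2) with h | h
  · rw [Real.sq_sqrt h]; congr 1; ring
  · rw [Real.sqrt_eq_zero_of_nonpos h.le, Real.sqrt_eq_zero_of_nonpos (by nlinarith [sq_nonneg ‖z‖]),
      Real.sqrt_eq_zero_of_nonpos (by nlinarith [sq_nonneg ‖z‖])]

variable [MeasurableSpace E] [BorelSpace E] [FiniteDimensional ℝ E]

theorem isRadialPair_sheets {R : ℝ} (hR : 0 < R) {F : E × ℝ → ℂ} (hF : ContDiff ℝ 1 F) :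
    IsRadialPair R (sheets R fun p => (p.2 : ℂ) * F p) (sheets R (tangential F)) := by
  have hh := continuous_height (E := E) R
  have hFc := hF.continuous
  refine ⟨?_, fun x hx => sheets_eq_zero hR.le hx _, ?_, integrable_sheets hR (continuous_tangential hF), ?_⟩
  · have : (sheets R fun p : E × ℝ => (p.2 : ℂ) * F p)
        = fun x => F (x, height R x) - F (x, -height R x) := funext (sheets_snd_mul R F)
    rw [this]; fun_prop
  · exact (measurable_sheets (continuous_tangential hF).measurable).stronglyMeasurable
  · intro x hx
    rcases lt_or_gt_of_ne hx with hx | hx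
    · simp only [sheets_snd_mul]
      have hs := hasDerivAt_height_smul hx
      have hx1 : HasDerivAt (fun t : ℝ => t • x) x 1 :=
        ((hasDerivAt_id (1:ℝ)).smul_const x).congr_deriv (by simp)
      have hd : ∀ p, HasFDerivAt F (fderiv ℝ F p) p := fun p =>
        (hF.differentiable one_ne_zero p).hasFDerivAt
      have e1 := (hd ((1:ℝ) • x, height R ((1:ℝ) • x))).comp_hasDerivAt (1:ℝ) (hx1.prodMk hs)
      have e2 := (hd ((1:ℝ) • x, -height R ((1:ℝ) • x))).comp_hasDerivAt (1:ℝ) (hx1.prodMk hs.neg)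
      refine (e1.sub e2).congr_deriv ?_
      have hsplit : ∀ (p : E × ℝ) (a : ℝ), fderiv ℝ F p (x, a)
          = fderiv ℝ F p (x, 0) + a * fderiv ℝ F p (0, 1) := fun p a => by
        rw [← Complex.real_smul, ← map_smul, ← map_add]; simp
      have h0 : (height R x : ℂ) ≠ 0 := by exact_mod_cast (height_pos hx).ne'
      rw [one_smul, hsplit, hsplit (x, -height R x)]
      simp only [sheets, tangential]
      push_cast
      field_simp
      ring
    · have : (fun t : ℝ => sheets R (fun p : E × ℝ => (p.2 : ℂ) * F p) (t • x)) =ᶠ[nhds 1] fun _ => 0 := by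
        have hc : Continuous fun t : ℝ => ‖t • x‖ := by fun_prop
        have : ∀ᶠ t : ℝ in nhds 1, R < ‖t • x‖ := hc.continuousAt.eventually (lt_mem_nhds (by simpa))
        filter_upwards [this] with t ht
        exact sheets_eq_zero hR.le ht.le _
      rw [sheets_eq_zero hR.le hx.le]
      exact (hasDerivAt_const _ _).congr_of_eventuallyEq this

theorem faceTerm_sheets (R : ℝ) (F : E × ℝ → ℂ) {v : E} (hv : ‖v‖ = 1) (d : ℝ) (l : List (E × ℝ)) :
    faceTerm (sheets R F) (v, d, l) = d * ∫ z in polyhedron (faceConstraints v d l),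
      sheets (√(R ^ 2 - d ^ 2)) (fun p : (ℝ ∙ v)ᗮ × ℝ => F (d • v + (p.1 : E), p.2)) z := by
  have : {z : (ℝ ∙ v)ᗮ | d • v + (z : E) ∈ polyhedron l} = polyhedron (faceConstraints v d l) := by
    ext z; exact (mem_polyhedron_faceConstraints v d l z).symm
  rw [faceTerm]
  simp only [this, sheets, height_face hv]

/-- The divergence formula on the two sheets of the sphere over a polyhedron. -/
theorem HasFaces.integral_sheets {l : List (E × ℝ)} {faces : List (E × ℝ × List (E × ℝ))}
    (h : HasFaces (polyhedron l) faces) {R : ℝ} (hR : 0 < R) {F : E × ℝ → ℂ} (hF : ContDiff ℝ 1 F) :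
    ∫ x in polyhedron l, sheets R
        (fun p => (Module.finrank ℝ E : ℂ) * ((p.2 : ℂ) * F p) + tangential F p) x
      = -(faces.map (faceTerm (sheets R fun p => (p.2 : ℂ) * F p))).sum := by
  rw [← h.2 R _ _ hR (isRadialPair_sheets hR hF)]
  simp only [sheets_add, sheets_const_mul]

end SheetsDivergence

section Kernel

/-- The logarithm and the negative powers. -/
noncomputable def kernel : ℕ → ℂ → ℂ
  | 0, ζ => Complex.log ζ
  | m + 1, ζ => (ζ ^ (m + 1))⁻¹

/-- The constants with `(kernel m)' = kernelCoeff m * kernel (m + 1)`. -/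
def kernelCoeff (m : ℕ) : ℂ := if m = 0 then 1 else -m

theorem kernelCoeff_ne_zero (m : ℕ) : kernelCoeff m ≠ 0 := by
  unfold kernelCoeff
  split_ifs with h
  · exact one_ne_zero
  · simpa using h

theorem hasDerivAt_kernel (m : ℕ) {ζ : ℂ} (hζ : ζ ∈ Complex.slitPlane) :
    HasDerivAt (kernel m) (kernelCoeff m * kernel (m + 1) ζ) ζ := by
  have h0 := Complex.slitPlane_ne_zero hζ
  rcases m with _ | m
  · exact (show HasDerivAt (kernel 0) ζ⁻¹ ζ from Complex.hasDerivAt_log hζ).congr_deriv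
      (by simp [kernelCoeff, kernel])
  · refine ((hasDerivAt_pow (m + 1) ζ).inv (pow_ne_zero _ h0)).congr_deriv ?_
    simp only [kernelCoeff, kernel]
    push_cast
    simp
    field_simp
    ring

theorem contDiffAt_kernel (m : ℕ) {ζ : ℂ} (hζ : ζ ∈ Complex.slitPlane) {n : WithTop ℕ∞} :
    ContDiffAt ℝ n (kernel m) ζ := by
  rcases m with _ | m
  · exact (Complex.contDiffAt_log hζ).restrict_scalars ℝ
  · exact (contDiffAt_id.pow (m + 1)).inv (pow_ne_zero _ (Complex.slitPlane_ne_zero hζ))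

variable {E : Type}

/-- The regularised height `σ` with regularisation `ε * c`. -/
noncomputable def regHeight (c : E → ℝ) (ε : ℝ) (p : E × ℝ) : ℂ :=
  ((ε * c p.1 : ℝ) : ℂ) + (p.2 : ℂ) * Complex.I

@[simp] theorem regHeight_re (c : E → ℝ) (ε : ℝ) (p : E × ℝ) :
    (regHeight c ε p).re = ε * c p.1 := by simp [regHeight]

@[simp] theorem regHeight_im (c : E → ℝ) (ε : ℝ) (p : E × ℝ) :
    (regHeight c ε p).im = p.2 := by simp [regHeight]

theorem abs_le_norm_regHeight (c : E → ℝ) (ε : ℝ) (p : E × ℝ) : |p.2| ≤ ‖regHeight c ε p‖ := by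
  simpa using Complex.abs_im_le_norm (regHeight c ε p)

theorem mul_le_norm_regHeight (c : E → ℝ) (ε : ℝ) (p : E × ℝ) : ε * c p.1 ≤ ‖regHeight c ε p‖ := by
  simpa using Complex.re_le_norm (regHeight c ε p)

theorem regHeight_mem_slitPlane {c : E → ℝ} {ε : ℝ} {p : E × ℝ} (h : 0 < ε * c p.1 ∨ p.2 ≠ 0) :
    regHeight c ε p ∈ Complex.slitPlane := by
  simpa [Complex.slitPlane] using h

/-- The kernel evaluated at the regularised height. -/
noncomputable def regKernel (c : E → ℝ) (m : ℕ) (ε : ℝ) (p : E × ℝ) : ℂ :=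
  kernel m (regHeight c ε p)

theorem tendsto_regKernel (c : E → ℝ) (m : ℕ) {p : E × ℝ} (hp : p.2 ≠ 0) :
    Tendsto (fun ε => regKernel c m ε p) (nhdsWithin 0 (Set.Ioi 0))
      (nhds (kernel m (p.2 * Complex.I))) := by
  have h0 : regHeight c 0 p = p.2 * Complex.I := by simp [regHeight]
  have h1 : Continuous fun ε : ℝ => regHeight c ε p := by unfold regHeight; fun_prop
  have h2 : ContinuousAt (kernel m) (regHeight c 0 p) :=
    (contDiffAt_kernel m (regHeight_mem_slitPlane (Or.inr hp)) (n := 0)).continuousAt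
  rw [← h0]
  exact (h2.comp (f := fun ε : ℝ => regHeight c ε p) h1.continuousAt).tendsto.mono_left nhdsWithin_le_nhds

variable [NormedAddCommGroup E] [InnerProductSpace ℝ E]

variable {c : E → ℝ} {ε : ℝ} (hc : ContDiff ℝ (⊤ : ℕ∞) c) (hc0 : ∀ x, 0 < c x) (hε : 0 < ε)
include hc hc0 hε

theorem contDiff_regKernel (m : ℕ) : ContDiff ℝ (⊤ : ℕ∞) (regKernel c m ε) := by
  rw [contDiff_iff_contDiffAt]
  intro p
  have h1 : ContDiff ℝ (⊤ : ℕ∞) (regHeight c ε) := by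
    have h2 : ContDiff ℝ (⊤ : ℕ∞) (fun p : E × ℝ => ε * c p.1) :=
      contDiff_const.mul (hc.comp contDiff_fst)
    exact (Complex.ofRealCLM.contDiff.comp h2).add
      ((Complex.ofRealCLM.contDiff.comp contDiff_snd).mul contDiff_const)
  exact (contDiffAt_kernel m (regHeight_mem_slitPlane (Or.inl (mul_pos hε (hc0 _))))).comp p
    h1.contDiffAt

theorem fderiv_regKernel (m : ℕ) (p q : E × ℝ) :
    fderiv ℝ (regKernel c m ε) p q = kernelCoeff m * regKernel c (m + 1) ε p *
      ((ε * fderiv ℝ c p.1 q.1 : ℝ) + q.2 * Complex.I) := by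
  have h1 : HasFDerivAt (fun p : E × ℝ => ε * c p.1)
      (ε • (fderiv ℝ c p.1).comp (ContinuousLinearMap.fst ℝ E ℝ)) p :=
    ((hc.differentiable (by simp) p.1).hasFDerivAt.comp p hasFDerivAt_fst).const_mul ε
  have h2 : HasFDerivAt (fun p : E × ℝ => (p.2 : ℂ) * Complex.I)
      ((Complex.ofRealCLM.comp (ContinuousLinearMap.snd ℝ E ℝ)).smulRight Complex.I) p := by
    have := ((Complex.ofRealCLM.hasFDerivAt (x := p.2)).comp p hasFDerivAt_snd).mul_const Complex.I
    refine this.congr_fderiv ?_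
    ext x <;> simp
  have h3 : HasFDerivAt (regHeight c ε) _ p :=
    ((Complex.ofRealCLM.hasFDerivAt).comp p h1).add h2
  have h4 := (hasDerivAt_kernel m (regHeight_mem_slitPlane (c := c) (ε := ε) (p := p)
    (Or.inl (mul_pos hε (hc0 _))))).comp_hasFDerivAt p h3
  have h5 : fderiv ℝ (regKernel c m ε) p = _ := h4.fderiv
  rw [h5]
  simp [regKernel]
  ring

theorem tangential_mul_regKernel {W : E × ℝ → ℂ} (hW : Differentiable ℝ W) (m : ℕ) (p : E × ℝ) :
    tangential (fun p => W p * regKernel c m ε p) p = tangential W p * regKernel c m ε p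
      + kernelCoeff m * ε * (p.2 * W p * (fderiv ℝ c p.1 p.1 : ℝ) * regKernel c (m + 1) ε p)
      - Complex.I * kernelCoeff m * ((‖p.1‖ ^ 2 : ℝ) * W p * regKernel c (m + 1) ε p) := by
  have hk := (contDiff_regKernel hc hc0 hε m).differentiable (by simp)
  have hm := fderiv_fun_mul (hW p) (hk p)
  rw [tangential, tangential, hm]
  simp only [add_apply, smul_apply, smul_eq_mul,
    fderiv_regKernel hc hc0 hε, map_zero]
  push_cast
  ring

end Kernel

section Relation

theorem integral_linear_combination {α : Type*} [MeasurableSpace α] {μ : Measure α}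
    {f₁ f₂ f₃ f₄ : α → ℂ} (h₁ : Integrable f₁ μ) (h₂ : Integrable f₂ μ) (h₃ : Integrable f₃ μ)
    (h₄ : Integrable f₄ μ) (a₂ a₃ a₄ : ℂ) :
    ∫ x, (f₁ x + a₂ * f₂ x - a₃ * f₃ x + a₄ * f₄ x) ∂μ
      = ∫ x, f₁ x ∂μ + a₂ * ∫ x, f₂ x ∂μ - a₃ * ∫ x, f₃ x ∂μ + a₄ * ∫ x, f₄ x ∂μ := by
  have h12 : Integrable (fun x => f₁ x + a₂ * f₂ x) μ := h₁.add (h₂.const_mul a₂)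
  have h123 : Integrable (fun x => f₁ x + a₂ * f₂ x - a₃ * f₃ x) μ := h12.sub (h₃.const_mul a₃)
  rw [integral_add h123 (h₄.const_mul a₄), integral_sub h12 (h₃.const_mul a₃),
    integral_add h₁ (h₂.const_mul a₂)]
  simp only [integral_const_mul]

/-- A polynomial inverse of `R ^ 2 - σ ^ 2` modulo `σ ^ (2 * N)`. -/
noncomputable def truncInv (R : ℝ) (N : ℕ) (σ : ℝ) : ℝ :=
  (R ^ 2)⁻¹ * ∑ j ∈ Finset.range N, ((σ / R) ^ 2) ^ j

theorem mul_truncInv {R : ℝ} (hR : R ≠ 0) (N : ℕ) (σ : ℝ) :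
    (R ^ 2 - σ ^ 2) * truncInv R N σ = 1 - ((σ / R) ^ 2) ^ N := by
  have h := geom_sum_mul ((σ / R) ^ 2) N
  have h2 : R ^ 2 - σ ^ 2 = -(R ^ 2 * ((σ / R) ^ 2 - 1)) := by field_simp; ring
  rw [truncInv, h2]
  have : R ^ 2 * (R ^ 2)⁻¹ = 1 := mul_inv_cancel₀ (pow_ne_zero _ hR)
  linear_combination -h - (((σ / R) ^ 2 - 1) * ∑ j ∈ Finset.range N, ((σ / R) ^ 2) ^ j) * this

theorem contDiff_truncInv (R : ℝ) (N : ℕ) : ContDiff ℝ (⊤ : ℕ∞) (truncInv R N) := by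
  unfold truncInv
  fun_prop

variable {E : Type} [NormedAddCommGroup E] [InnerProductSpace ℝ E]

/-- The weight `w` divided by `R ^ 2 - σ ^ 2`, modulo high powers of `σ`. -/
noncomputable def divWeight (R : ℝ) (N : ℕ) (w : E × ℝ → ℂ) (p : E × ℝ) : ℂ :=
  (truncInv R N p.2 : ℂ) * w p

theorem contDiff_divWeight (R : ℝ) (N : ℕ) {w : E × ℝ → ℂ} (hw : ContDiff ℝ (⊤ : ℕ∞) w) :
    ContDiff ℝ (⊤ : ℕ∞) (divWeight R N w) :=
  (Complex.ofRealCLM.contDiff.comp ((contDiff_truncInv R N).comp contDiff_snd)).mul hw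

theorem contDiff_tangential {w : E × ℝ → ℂ} (hw : ContDiff ℝ (⊤ : ℕ∞) w) :
    ContDiff ℝ (⊤ : ℕ∞) (tangential w) := by
  have h : ContDiff ℝ (⊤ : ℕ∞) (fderiv ℝ w) := hw.fderiv_right (by simp)
  have h1 : ContDiff ℝ (⊤ : ℕ∞) fun p : E × ℝ => fderiv ℝ w p (p.1, 0) :=
    h.clm_apply (contDiff_fst.prodMk contDiff_const)
  have h2 : ContDiff ℝ (⊤ : ℕ∞) fun p : E × ℝ => fderiv ℝ w p (0, 1) := h.clm_apply contDiff_const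
  have h3 : ContDiff ℝ (⊤ : ℕ∞) fun p : E × ℝ => (p.2 : ℂ) :=
    Complex.ofRealCLM.contDiff.comp contDiff_snd
  have h4 : ContDiff ℝ (⊤ : ℕ∞) fun p : E × ℝ => ((‖p.1‖ ^ 2 : ℝ) : ℂ) :=
    Complex.ofRealCLM.contDiff.comp ((contDiff_norm_sq ℝ).comp contDiff_fst)
  exact (h3.mul h1).sub (h4.mul h2)

variable [MeasurableSpace E] [BorelSpace E] [FiniteDimensional ℝ E]

/-- The regularised spherical integral over the part of the sphere lying over `K`. -/
noncomputable def sphericalIntegral (K : Set E) (R : ℝ) (w : E × ℝ → ℂ) (c : E → ℝ) (m : ℕ)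
    (ε : ℝ) : ℂ :=
  ∫ x in K, sheets R (fun p => w p * regKernel c m ε p) x

/-- The weight in lower order terms of the integration by parts. -/
noncomputable def lowerWeight (R : ℝ) (N : ℕ) (w : E × ℝ → ℂ) (p : E × ℝ) : ℂ :=
  (Module.finrank ℝ E : ℂ) * ((p.2 : ℂ) * divWeight R N w p) + tangential (divWeight R N w) p

/-- Integration by parts lowers the order of the kernel. -/
theorem HasFaces.sphericalIntegral_relation {l : List (E × ℝ)} {faces : List (E × ℝ × List (E × ℝ))}
    (h : HasFaces (polyhedron l) faces) {R : ℝ} (hR : 0 < R) (N : ℕ) {w : E × ℝ → ℂ}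
    (hw : ContDiff ℝ (⊤ : ℕ∞) w) {c : E → ℝ} (hc : ContDiff ℝ (⊤ : ℕ∞) c) (hc0 : ∀ x, 0 < c x)
    (m : ℕ) {ε : ℝ} (hε : 0 < ε) :
    sphericalIntegral (polyhedron l) R (lowerWeight R N w) c m ε
      + kernelCoeff m * (ε * sphericalIntegral (polyhedron l) R
          (fun p => p.2 * divWeight R N w p * (fderiv ℝ c p.1 p.1 : ℝ)) c (m + 1) ε)
      - Complex.I * kernelCoeff m * sphericalIntegral (polyhedron l) R w c (m + 1) ε
      + Complex.I * kernelCoeff m * sphericalIntegral (polyhedron l) R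
          (fun p => ((((p.2 / R) ^ 2) ^ N : ℝ) : ℂ) * w p) c (m + 1) ε
      = -(faces.map fun F => (F.2.1 : ℂ) *
          sphericalIntegral (polyhedron (faceConstraints F.1 F.2.1 F.2.2)) (√(R ^ 2 - F.2.1 ^ 2))
            (fun p => (p.2 : ℂ) * divWeight R N w (F.2.1 • F.1 + (p.1 : E), p.2))
            (fun z => c (F.2.1 • F.1 + (z : E))) m ε).sum := by
  set W := divWeight R N w with hWdef
  have hW : ContDiff ℝ (⊤ : ℕ∞) W := contDiff_divWeight R N hw
  have hk := fun m => contDiff_regKernel hc hc0 hε m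
  have hkc : ∀ m, Continuous (regKernel c m ε) := fun m => (hk m).continuous
  have hF : ContDiff ℝ 1 (fun p => W p * regKernel c m ε p) :=
    (hW.mul (hk m)).of_le (by exact_mod_cast le_top)
  have hWc := hW.continuous
  have hwc := hw.continuous
  have hTc := (contDiff_tangential hW).continuous
  have hcc : Continuous fun p : E × ℝ => ((fderiv ℝ c p.1 p.1 : ℝ) : ℂ) :=
    Complex.continuous_ofReal.comp (((hc.continuous_fderiv (by simp)).comp continuous_fst).clm_apply
      continuous_fst)
  have hrel := h.integral_sheets hR hF
  have hfaces : (faces.map (faceTerm (sheets R fun p => (p.2 : ℂ) * (W p * regKernel c m ε p))))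
      = faces.map fun F => (F.2.1 : ℂ) *
          sphericalIntegral (polyhedron (faceConstraints F.1 F.2.1 F.2.2)) (√(R ^ 2 - F.2.1 ^ 2))
            (fun p => (p.2 : ℂ) * W (F.2.1 • F.1 + (p.1 : E), p.2))
            (fun z => c (F.2.1 • F.1 + (z : E))) m ε := by
    refine List.map_congr_left fun F hF => ?_
    rw [show F = (F.1, F.2.1, F.2.2) from rfl, faceTerm_sheets R _ (h.1 F hF)]
    simp only [sphericalIntegral, ← mul_assoc]
    rfl
  rw [← hfaces, ← hrel]
  have h1 : Integrable (sheets R fun p => lowerWeight R N w p * regKernel c m ε p) :=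
    integrable_sheets hR (by unfold lowerWeight; rw [← hWdef]; fun_prop)
  have h2 : Integrable (sheets R fun p =>
      (p.2 * W p * (fderiv ℝ c p.1 p.1 : ℝ)) * regKernel c (m + 1) ε p) :=
    integrable_sheets hR (by fun_prop)
  have h3 : Integrable (sheets R fun p => w p * regKernel c (m + 1) ε p) :=
    integrable_sheets hR (by fun_prop)
  have h4 : Integrable (sheets R fun p =>
      (((((p.2 / R) ^ 2) ^ N : ℝ) : ℂ) * w p) * regKernel c (m + 1) ε p) :=
    integrable_sheets hR (by fun_prop)
  simp only [sphericalIntegral]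
  rw [← mul_assoc, ← integral_linear_combination h1.integrableOn h2.integrableOn h3.integrableOn
    h4.integrableOn]
  congr 1
  ext x
  rw [sub_eq_add_neg, ← neg_mul]
  simp only [← sheets_const_mul, ← sheets_add]
  refine congrFun (sheets_congr hR.le fun x σ hx h0 hσ => ?_) x
  simp only [tangential_mul_regKernel hc hc0 hε (hW.differentiable (by simp)), lowerWeight]
  have hθ : ((‖x‖ ^ 2 : ℝ) : ℂ) * W (x, σ) = (1 - ((((σ / R) ^ 2) ^ N : ℝ) : ℂ)) * w (x, σ) := by
    rw [hWdef, divWeight, ← mul_assoc]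
    congr 1
    have := mul_truncInv hR.ne' N σ
    rw [show R ^ 2 - σ ^ 2 = ‖x‖ ^ 2 by linarith] at this
    exact_mod_cast this
  rw [← hWdef]
  linear_combination Complex.I * kernelCoeff m * regKernel c (m + 1) ε (x, σ) * hθ

end Relation

section CommonLimit

variable {E : Type} [NormedAddCommGroup E] [InnerProductSpace ℝ E]

/-- Smooth regularisations that are bounded below by a positive constant. -/
def IsRegularization (c : E → ℝ) : Prop :=
  ContDiff ℝ (⊤ : ℕ∞) c ∧ ∃ c₀ > 0, ∀ x, c₀ ≤ c x

theorem IsRegularization.pos {c : E → ℝ} (h : IsRegularization c) (x : E) : 0 < c x := by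
  obtain ⟨c₀, h0, h1⟩ := h.2
  exact h0.trans_le (h1 x)

/-- The quantities `f c ε` have a limit as `ε → 0⁺` which is independent of the regularisation
`c`, and which vanishes unless `b = 0`. -/
def HasCommonLimit (b : ℕ) (f : (E → ℝ) → ℝ → ℂ) : Prop :=
  ∃ L : ℂ, (b ≠ 0 → L = 0) ∧ ∀ c, IsRegularization c →
    Tendsto (f c) (nhdsWithin 0 (Set.Ioi 0)) (nhds L)

theorem HasCommonLimit.add {b : ℕ} {f g : (E → ℝ) → ℝ → ℂ} (hf : HasCommonLimit b f)
    (hg : HasCommonLimit b g) : HasCommonLimit b fun c ε => f c ε + g c ε := by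
  obtain ⟨L, h1, h2⟩ := hf
  obtain ⟨L', h1', h2'⟩ := hg
  exact ⟨L + L', fun hb => by rw [h1 hb, h1' hb, add_zero], fun c hc => (h2 c hc).add (h2' c hc)⟩

theorem HasCommonLimit.const_mul {b : ℕ} {f : (E → ℝ) → ℝ → ℂ} (hf : HasCommonLimit b f) (a : ℂ) :
    HasCommonLimit b fun c ε => a * f c ε := by
  obtain ⟨L, h1, h2⟩ := hf
  exact ⟨a * L, fun hb => by rw [h1 hb, mul_zero], fun c hc => (h2 c hc).const_mul a⟩

theorem HasCommonLimit.list_sum {b : ℕ} {ι : Type*} (s : List ι) {f : ι → (E → ℝ) → ℝ → ℂ}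
    (hf : ∀ i ∈ s, HasCommonLimit b (f i)) :
    HasCommonLimit b fun c ε => (s.map fun i => f i c ε).sum := by
  induction s with
  | nil => exact ⟨0, fun _ => rfl, fun _ _ => by simp⟩
  | cons i s ih =>
    simp only [List.map_cons, List.sum_cons]
    exact (hf i (by simp)).add (ih fun j hj => hf j (by simp [hj]))

theorem HasCommonLimit.congr {b : ℕ} {f g : (E → ℝ) → ℝ → ℂ} (hf : HasCommonLimit b f)
    (h : ∀ c, IsRegularization c → ∀ ε, 0 < ε → f c ε = g c ε) : HasCommonLimit b g := by
  obtain ⟨L, h1, h2⟩ := hf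
  refine ⟨L, h1, fun c hc => (h2 c hc).congr' ?_⟩
  filter_upwards [self_mem_nhdsWithin] with ε hε using h c hc ε hε

variable [MeasurableSpace E] [BorelSpace E] [FiniteDimensional ℝ E]

/-- The regularised spherical integrals over `K`, multiplied by `ε ^ b`, converge. -/
def ConvergesOn (K : Set E) (R : ℝ) (w : E × ℝ → ℂ) (b m : ℕ) : Prop :=
  HasCommonLimit b fun c ε => (ε : ℂ) ^ b * sphericalIntegral K R w c m ε

theorem convergesOn_of_bound (K : Set E) {R : ℝ} (hR : 0 < R) {w : E × ℝ → ℂ} (hw : Continuous w)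
    (b m : ℕ) (h : ∀ c, IsRegularization c → ∃ C, ∀ ε : ℝ, 0 < ε → ε < 1 → ∀ x : E, ∀ σ : ℝ, ‖x‖ ≤ R →
      σ ≠ 0 → |σ| ≤ R →
      ‖(ε : ℂ) ^ b * (w (x, σ) * regKernel c m ε (x, σ))‖ ≤ C * |σ| ^ (-(1 / 2) : ℝ)) :
    ConvergesOn K R w b m := by
  refine ⟨∫ x in K, sheets R (fun p => 0 ^ b * (w p * kernel m (p.2 * Complex.I))) x,
    fun hb => by simp [zero_pow hb, sheets], fun c hc => ?_⟩
  obtain ⟨C, hC⟩ := h c hc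
  have h1 := tendsto_integral_sheets hR K
    (F := fun ε p => (ε : ℂ) ^ b * (w p * regKernel c m ε p))
    (G := fun p => 0 ^ b * (w p * kernel m (p.2 * Complex.I))) (C := C) ?_ hC ?_
  · simpa only [sphericalIntegral, sheets_const_mul, integral_const_mul] using h1
  · intro ε hε
    have := (contDiff_regKernel hc.1 hc.pos hε m).continuous
    exact Continuous.measurable (by fun_prop)
  · intro x σ hσ
    have h2 : Tendsto (fun ε : ℝ => (ε : ℂ) ^ b) (nhdsWithin 0 (Set.Ioi 0)) (nhds (0 ^ b)) := by
      have : Continuous fun ε : ℝ => (ε : ℂ) ^ b := by fun_prop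
      simpa using (this.tendsto 0).mono_left nhdsWithin_le_nhds
    exact h2.mul ((tendsto_regKernel c m (p := (x, σ)) hσ).const_mul _)

theorem norm_log_le {ζ : ℂ} {s B : ℝ} (hs : 0 < s) (h1 : s ≤ ‖ζ‖) (h2 : ‖ζ‖ ≤ B) :
    ‖Complex.log ζ‖ ≤ B + 2 * s ^ (-(1 / 2) : ℝ) + Real.pi := by
  have h0 := hs.trans_le h1
  have h3 : |Real.log ‖ζ‖| ≤ B + 2 * s ^ (-(1 / 2) : ℝ) := by
    have h4 : 0 ≤ s ^ (-(1 / 2) : ℝ) := Real.rpow_nonneg hs.le _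
    rw [abs_le]
    constructor
    · have h5 := Real.log_le_rpow_div (inv_nonneg.2 hs.le) (ε := 1 / 2) (by norm_num)
      rw [Real.log_inv, Real.inv_rpow hs.le, ← Real.rpow_neg hs.le] at h5
      have := Real.log_le_log hs h1
      linarith
    · have := Real.log_le_sub_one_of_pos h0
      linarith
  have h6 : ‖Complex.log ζ‖ ≤ |(Complex.log ζ).re| + |(Complex.log ζ).im| :=
    Complex.norm_le_abs_re_add_abs_im _
  have h7 := Complex.abs_arg_le_pi ζ
  rw [Complex.log_re, Complex.log_im] at h6
  linarith

theorem convergesOn_zero (K : Set E) {R : ℝ} (hR : 0 < R) {w : E × ℝ → ℂ} (hw : Continuous w)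
    (b : ℕ) : ConvergesOn K R w b 0 := by
  refine convergesOn_of_bound K hR hw b 0 fun c hc => ?_
  obtain ⟨M, hM0, hM⟩ := exists_bound_of_continuous hw R
  obtain ⟨B, hB0, hB⟩ := exists_bound_of_continuous
    (F := fun p : E × ℝ => (c p.1 : ℂ)) (by have := hc.1.continuous; fun_prop) R
  refine ⟨M * ((B + R + Real.pi) * √R + 2), fun ε h0 h1 x σ hx hσ0 hσ => ?_⟩
  have hcx := hB x σ hx hσ
  rw [Complex.norm_real] at hcx
  have h2 : ‖regHeight c ε (x, σ)‖ ≤ B + R := by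
    refine (Complex.norm_le_abs_re_add_abs_im _).trans ?_
    rw [regHeight_re, regHeight_im, abs_mul, abs_of_pos h0]
    refine add_le_add ?_ hσ
    exact (mul_le_of_le_one_left (abs_nonneg _) h1.le).trans hcx
  have h3 := norm_log_le (abs_pos.2 hσ0) (abs_le_norm_regHeight c ε (x, σ)) h2
  have h4 := one_le_mul_rpow_neg_half hσ0 hσ
  have h5 : ‖(ε : ℂ) ^ b‖ ≤ 1 := by
    rw [norm_pow, Complex.norm_real, Real.norm_of_nonneg h0.le]
    exact pow_le_one₀ h0.le h1.le
  have hpi := Real.pi_pos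
  have h6 : 0 ≤ B + R + Real.pi := by positivity
  have h7 : ‖regKernel c 0 ε (x, σ)‖ ≤
      ((B + R + Real.pi) * √R + 2) * |σ| ^ (-(1 / 2) : ℝ) := by
    refine h3.trans ?_
    nlinarith
  rw [norm_mul, norm_mul, mul_assoc M]
  calc _ ≤ 1 * (M * (((B + R + Real.pi) * √R + 2) * |σ| ^ (-(1 / 2) : ℝ))) := by
        gcongr
        exact hM x σ hx hσ
    _ = _ := one_mul _

theorem norm_kernel_succ (m : ℕ) (ζ : ℂ) : ‖kernel (m + 1) ζ‖ = (‖ζ‖ ^ (m + 1))⁻¹ := by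
  simp [kernel]

theorem convergesOn_of_lt (K : Set E) {R : ℝ} (hR : 0 < R) {w : E × ℝ → ℂ} (hw : Continuous w)
    {b m : ℕ} (hb : m < b) : ConvergesOn K R w b (m + 1) := by
  refine convergesOn_of_bound K hR hw b (m + 1) fun c hc => ?_
  obtain ⟨M, hM0, hM⟩ := exists_bound_of_continuous hw R
  obtain ⟨c₀, hc0, hc1⟩ := hc.2
  refine ⟨M * (c₀ ^ (m + 1))⁻¹ * √R, fun ε h0 h1 x σ hx hσ0 hσ => ?_⟩
  have h4 := one_le_mul_rpow_neg_half hσ0 hσ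
  have h5 : ‖(ε : ℂ) ^ b‖ ≤ ε ^ (m + 1) := by
    rw [norm_pow, Complex.norm_real, Real.norm_of_nonneg h0.le]
    exact pow_le_pow_of_le_one h0.le h1.le hb
  have h6 : ε * c₀ ≤ ‖regHeight c ε (x, σ)‖ :=
    (mul_le_mul_of_nonneg_left (hc1 x) h0.le).trans (mul_le_norm_regHeight c ε (x, σ))
  have h7 : ‖regKernel c (m + 1) ε (x, σ)‖ ≤ ((ε * c₀) ^ (m + 1))⁻¹ := by
    rw [regKernel, norm_kernel_succ]
    gcongr
  rw [norm_mul, norm_mul, mul_assoc _ √R]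
  calc _ ≤ ε ^ (m + 1) * (M * ((ε * c₀) ^ (m + 1))⁻¹) := by
        gcongr
        exact hM x σ hx hσ
    _ = M * (c₀ ^ (m + 1))⁻¹ := by rw [mul_pow]; field_simp
    _ ≤ _ := le_mul_of_one_le_right (by positivity) h4

theorem convergesOn_pow_mul (K : Set E) {R : ℝ} (hR : 0 < R) {w : E × ℝ → ℂ} (hw : Continuous w)
    (b m : ℕ) :
    ConvergesOn K R (fun p => ((((p.2 / R) ^ 2) ^ (m + 1) : ℝ) : ℂ) * w p) b (m + 1) := by
  refine convergesOn_of_bound K hR (by fun_prop) b (m + 1) fun c hc => ?_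
  obtain ⟨M, hM0, hM⟩ := exists_bound_of_continuous hw R
  refine ⟨(R ^ (m + 1))⁻¹ * M * √R, fun ε h0 h1 x σ hx hσ0 hσ => ?_⟩
  have h4 := one_le_mul_rpow_neg_half hσ0 hσ
  have hs := abs_pos.2 hσ0
  have h5 : ‖(ε : ℂ) ^ b‖ ≤ 1 := by
    rw [norm_pow, Complex.norm_real, Real.norm_of_nonneg h0.le]
    exact pow_le_one₀ h0.le h1.le
  have h7 : ‖regKernel c (m + 1) ε (x, σ)‖ ≤ (|σ| ^ (m + 1))⁻¹ := by
    rw [regKernel, norm_kernel_succ]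
    gcongr
    exact abs_le_norm_regHeight c ε (x, σ)
  have h8 : ‖((((σ / R) ^ 2) ^ (m + 1) : ℝ) : ℂ)‖ ≤ (|σ| / R) ^ (m + 1) := by
    rw [Complex.norm_real, Real.norm_of_nonneg (by positivity), ← sq_abs, abs_div,
      abs_of_pos hR]
    gcongr
    have : |σ| / R ≤ 1 := (div_le_one hR).2 hσ
    have : 0 ≤ |σ| / R := by positivity
    nlinarith
  rw [norm_mul, norm_mul, norm_mul, mul_assoc _ √R]
  calc _ ≤ 1 * ((|σ| / R) ^ (m + 1) * M * (|σ| ^ (m + 1))⁻¹) := by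
        gcongr
        exact hM x σ hx hσ
    _ = (R ^ (m + 1))⁻¹ * M := by rw [div_pow]; field_simp
    _ ≤ _ := le_mul_of_one_le_right (by positivity) h4

theorem convergesOn_radius_zero (K : Set E) (w : E × ℝ → ℂ) (b m : ℕ) :
    ConvergesOn K 0 w b m :=
  ⟨0, fun _ => rfl, fun c _ => by
    have h (F : E × ℝ → ℂ) (x : E) : sheets 0 F x = 0 := sheets_eq_zero le_rfl (norm_nonneg x) F
    simp [sphericalIntegral, h]⟩

end CommonLimit

section Convergence

theorem IsRegularization.comp_affine {E : Type} [NormedAddCommGroup E] [InnerProductSpace ℝ E]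
    {c : E → ℝ} (hc : IsRegularization c) (x : E) (S : Submodule ℝ E) :
    IsRegularization fun z : S => c (x + z) := by
  obtain ⟨c₀, h0, h1⟩ := hc.2
  exact ⟨hc.1.comp (contDiff_const.add S.subtypeL.contDiff), c₀, h0, fun z => h1 _⟩

variable {E : Type} [NormedAddCommGroup E] [InnerProductSpace ℝ E]

theorem contDiff_lowerWeight (R : ℝ) (N : ℕ) {w : E × ℝ → ℂ} (hw : ContDiff ℝ (⊤ : ℕ∞) w) :
    ContDiff ℝ (⊤ : ℕ∞) (lowerWeight R N w) := by
  have h1 := contDiff_divWeight R N hw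
  have h3 : ContDiff ℝ (⊤ : ℕ∞) fun p : E × ℝ => (p.2 : ℂ) :=
    Complex.ofRealCLM.contDiff.comp contDiff_snd
  exact (contDiff_const.mul (h3.mul h1)).add (contDiff_tangential h1)

variable [MeasurableSpace E] [BorelSpace E] [FiniteDimensional ℝ E]

/-- Convergence for the kernels of order `m + 1` over polyhedra, given convergence for lower order
kernels, for higher powers of `ε`, and in the faces. -/
theorem convergesOn_succ_of_faces
    (hface : ∀ v : E, ‖v‖ = 1 → ∀ (l : List ((ℝ ∙ v)ᗮ × ℝ)) (R : ℝ), 0 ≤ R →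
      ∀ w : (ℝ ∙ v)ᗮ × ℝ → ℂ, ContDiff ℝ (⊤ : ℕ∞) w → ∀ b m, ConvergesOn (polyhedron l) R w b m)
    (l : List (E × ℝ)) {R : ℝ} (hR : 0 < R) {b m : ℕ}
    (hm : ∀ w : E × ℝ → ℂ, ContDiff ℝ (⊤ : ℕ∞) w → ConvergesOn (polyhedron l) R w b m)
    (hb : ∀ w : E × ℝ → ℂ, ContDiff ℝ (⊤ : ℕ∞) w → ConvergesOn (polyhedron l) R w (b + 1) (m + 1))
    {w : E × ℝ → ℂ} (hw : ContDiff ℝ (⊤ : ℕ∞) w) :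
    ConvergesOn (polyhedron l) R w b (m + 1) := by
  obtain ⟨faces, hfaces⟩ := exists_hasFaces l
  have h3 : ContDiff ℝ (⊤ : ℕ∞) fun p : E × ℝ => (p.2 : ℂ) :=
    Complex.ofRealCLM.contDiff.comp contDiff_snd
  have hdiv := contDiff_divWeight R (m + 1) hw
  have hk := kernelCoeff_ne_zero m
  have hlow := hm _ (contDiff_lowerWeight R (m + 1) hw)
  have hreg : HasCommonLimit b fun c ε => (ε : ℂ) ^ (b + 1) * sphericalIntegral (polyhedron l) R
      (fun p => p.2 * divWeight R (m + 1) w p * (fderiv ℝ c p.1 p.1 : ℝ)) c (m + 1) ε := by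
    refine ⟨0, fun _ => rfl, fun c hc => ?_⟩
    have h4 : ContDiff ℝ (⊤ : ℕ∞) fun p : E × ℝ => ((fderiv ℝ c p.1 p.1 : ℝ) : ℂ) := by
      have h5 : ContDiff ℝ (⊤ : ℕ∞) (fderiv ℝ c) := hc.1.fderiv_right (by simp)
      exact Complex.ofRealCLM.contDiff.comp ((h5.comp contDiff_fst).clm_apply contDiff_fst)
    obtain ⟨L, h0, h⟩ := hb _ ((h3.mul hdiv).mul h4)
    rw [← h0 b.succ_ne_zero]
    exact h c hc
  have hpow := convergesOn_pow_mul (polyhedron l) hR hw.continuous b m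
  have hsum : HasCommonLimit b fun c ε => (faces.map fun F => (F.2.1 : ℂ) * ((ε : ℂ) ^ b *
      sphericalIntegral (polyhedron (faceConstraints F.1 F.2.1 F.2.2)) (√(R ^ 2 - F.2.1 ^ 2))
        (fun p => (p.2 : ℂ) * divWeight R (m + 1) w (F.2.1 • F.1 + (p.1 : E), p.2))
        (fun z => c (F.2.1 • F.1 + (z : E))) m ε)).sum := by
    refine HasCommonLimit.list_sum faces fun F hF => HasCommonLimit.const_mul ?_ _
    have h4 : ContDiff ℝ (⊤ : ℕ∞) fun p : (ℝ ∙ F.1)ᗮ × ℝ =>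
        (p.2 : ℂ) * divWeight R (m + 1) w (F.2.1 • F.1 + (p.1 : E), p.2) := by
      refine (Complex.ofRealCLM.contDiff.comp contDiff_snd).mul (hdiv.comp ?_)
      exact (contDiff_const.add ((ℝ ∙ F.1)ᗮ.subtypeL.contDiff.comp contDiff_fst)).prodMk contDiff_snd
    obtain ⟨L, h0, h⟩ := hface F.1 (hfaces.1 F hF) (faceConstraints F.1 F.2.1 F.2.2)
      (√(R ^ 2 - F.2.1 ^ 2)) (Real.sqrt_nonneg _) _ h4 b m
    exact ⟨L, h0, fun c hc => h _ (hc.comp_affine _ _)⟩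
  have htotal := (((hlow.const_mul (Complex.I * kernelCoeff m)⁻¹).add
    (hreg.const_mul (Complex.I⁻¹))).add hpow).add
    (hsum.const_mul (Complex.I * kernelCoeff m)⁻¹)
  refine htotal.congr fun c hc ε hε => ?_
  have hrel := hfaces.sphericalIntegral_relation hR (m + 1) hw hc.1 hc.pos m hε
  have hlist : (faces.map fun F => (F.2.1 : ℂ) * ((ε : ℂ) ^ b *
      sphericalIntegral (polyhedron (faceConstraints F.1 F.2.1 F.2.2)) (√(R ^ 2 - F.2.1 ^ 2))
        (fun p => (p.2 : ℂ) * divWeight R (m + 1) w (F.2.1 • F.1 + (p.1 : E), p.2))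
        (fun z => c (F.2.1 • F.1 + (z : E))) m ε)).sum = (ε : ℂ) ^ b *
      (faces.map fun F => (F.2.1 : ℂ) *
      sphericalIntegral (polyhedron (faceConstraints F.1 F.2.1 F.2.2)) (√(R ^ 2 - F.2.1 ^ 2))
        (fun p => (p.2 : ℂ) * divWeight R (m + 1) w (F.2.1 • F.1 + (p.1 : E), p.2))
        (fun z => c (F.2.1 • F.1 + (z : E))) m ε).sum := by
    rw [← List.sum_map_mul_left]
    congr 1
    refine List.map_congr_left fun F _ => by ring
  rw [hlist, ← neg_eq_iff_eq_neg.2 hrel]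
  have hI := Complex.I_ne_zero
  field_simp
  ring

/-- The regularised integrals over spherical polyhedra converge, and the limit does not depend on
the regularisation. -/
theorem convergesOn_polyhedron (k : ℕ) : ∀ (E : Type) [NormedAddCommGroup E]
    [InnerProductSpace ℝ E] [MeasurableSpace E] [BorelSpace E] [FiniteDimensional ℝ E],
    Module.finrank ℝ E = k → ∀ (l : List (E × ℝ)) (R : ℝ), 0 ≤ R →
      ∀ w : E × ℝ → ℂ, ContDiff ℝ (⊤ : ℕ∞) w → ∀ b m, ConvergesOn (polyhedron l) R w b m := by
  induction k using Nat.strong_induction_on with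
  | _ k ih =>
    intro E _ _ _ _ _ hE l R hR w hw b m
    rcases hR.eq_or_lt with rfl | hR
    · exact convergesOn_radius_zero _ w b m
    have hface : ∀ v : E, ‖v‖ = 1 → ∀ (l : List ((ℝ ∙ v)ᗮ × ℝ)) (R : ℝ), 0 ≤ R →
        ∀ w : (ℝ ∙ v)ᗮ × ℝ → ℂ, ContDiff ℝ (⊤ : ℕ∞) w →
          ∀ b m, ConvergesOn (polyhedron l) R w b m := fun v hv =>
      ih _ (by have := finrank_orthogonal_span_unit hv; omega) _ rfl
    induction m generalizing w b with
    | zero => exact convergesOn_zero _ hR hw.continuous b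
    | succ m ihm =>
      obtain ⟨d, hd⟩ : ∃ d, m + 1 ≤ b + d := ⟨m + 1, by omega⟩
      induction d generalizing w b with
      | zero => exact convergesOn_of_lt _ hR hw.continuous (by omega)
      | succ d ihd =>
        exact convergesOn_succ_of_faces hface l hR (fun w hw => ihm w hw b)
          (fun w hw => ihd w hw (b + 1) (by omega)) hw

end Convergence

section Polar

variable {E : Type} [NormedAddCommGroup E] [InnerProductSpace ℝ E] [MeasurableSpace E]
  [BorelSpace E] [FiniteDimensional ℝ E]

theorem lintegral_eq_lintegral_toSphere [Nontrivial E] {f : E → ENNReal} (hf : Measurable f) :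
    ∫⁻ x, f x = ∫⁻ u, (∫⁻ r in Set.Ioi (0 : ℝ),
      ENNReal.ofReal (r ^ (Module.finrank ℝ E - 1)) * f (r • (u : E)))
        ∂(volume : Measure E).toSphere := by
  have h1 : ∫⁻ x, f x = ∫⁻ x : ({0}ᶜ : Set E), f x ∂((volume : Measure E).comap Subtype.val) := by
    rw [lintegral_subtype_comap (measurableSet_singleton _).compl, restrict_compl_singleton]
  have h2 := ((volume : Measure E).measurePreserving_homeomorphUnitSphereProd).lintegral_comp
    (f := fun p => f ((p.2 : ℝ) • (p.1 : E))) (by fun_prop)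
  have h3 : ∀ x : ({0}ᶜ : Set E), ((homeomorphUnitSphereProd E x).2 : ℝ) •
      ((homeomorphUnitSphereProd E x).1 : E) = x := by
    intro x
    exact congrArg Subtype.val ((homeomorphUnitSphereProd E).symm_apply_apply x)
  simp only [h3] at h2
  rw [h1, h2, lintegral_prod _ (by fun_prop)]
  refine lintegral_congr fun u => ?_
  rw [Measure.volumeIoiPow, lintegral_withDensity_eq_lintegral_mul _ (by fun_prop) (by fun_prop)]
  rw [← lintegral_subtype_comap measurableSet_Ioi
    (fun r => ENNReal.ofReal (r ^ (Module.finrank ℝ E - 1)) * f (r • (u : E)))]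
  rfl

/-- Change of variables for a radial map. -/
theorem setLIntegral_radial [Nontrivial E] {s : Set ℝ} (hs : MeasurableSet s) (hs0 : s ⊆ Set.Ioi 0)
    {φ φ' : ℝ → ℝ} (hφ : ∀ r ∈ s, HasDerivAt φ (φ' r) r) (hinj : Set.InjOn φ s)
    (hpos : φ '' s = Set.Ioi 0) (hφm : Measurable φ) (hφm' : Measurable φ')
    {f : E → ENNReal} (hf : Measurable f) :
    ∫⁻ x, f x = ∫⁻ x in {x : E | ‖x‖ ∈ s},
      ENNReal.ofReal (|φ' ‖x‖| * (φ ‖x‖ / ‖x‖) ^ (Module.finrank ℝ E - 1))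
        * f ((φ ‖x‖ / ‖x‖) • x) := by
  have hms : MeasurableSet {x : E | ‖x‖ ∈ s} := measurable_norm hs
  rw [← lintegral_indicator hms, lintegral_eq_lintegral_toSphere hf,
    lintegral_eq_lintegral_toSphere (Measurable.indicator (by fun_prop) hms)]
  refine lintegral_congr fun u => ?_
  have hu : ‖(u : E)‖ = 1 := by simp
  rw [← hpos, lintegral_image_eq_lintegral_abs_deriv_mul hs
    (fun r hr => (hφ r hr).hasDerivWithinAt) hinj, hpos, ← lintegral_indicator hs,
    ← lintegral_indicator measurableSet_Ioi]
  refine lintegral_congr fun r => ?_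
  by_cases hr : r ∈ s
  · have hr0 : 0 < r := hs0 hr
    have hn : ‖r • (u : E)‖ = r := by rw [norm_smul, hu, mul_one, Real.norm_of_nonneg hr0.le]
    have hφ0 : φ r ∈ Set.Ioi 0 := hpos ▸ Set.mem_image_of_mem φ hr
    rw [Set.indicator_of_mem hr, Set.indicator_of_mem (Set.mem_Ioi.2 hr0),
      Set.indicator_of_mem (by simpa only [Set.mem_ofPred_eq, hn] using hr), hn, smul_smul,
      div_mul_cancel₀ _ hr0.ne', ← mul_assoc, ← mul_assoc, ← ENNReal.ofReal_mul (abs_nonneg _),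
      ← ENNReal.ofReal_mul (by positivity)]
    congr 2
    rw [div_pow]
    field_simp
  · rw [Set.indicator_of_notMem hr]
    by_cases hr0 : r ∈ Set.Ioi (0 : ℝ)
    · have hn : ‖r • (u : E)‖ = r := by
        rw [norm_smul, hu, mul_one, Real.norm_of_nonneg (le_of_lt hr0)]
      rw [Set.indicator_of_mem hr0, Set.indicator_of_notMem
        (by simpa only [Set.mem_ofPred_eq, hn] using hr), mul_zero]
    · rw [Set.indicator_of_notMem hr0]

end Polar

section Gnomonic

variable {E : Type} [NormedAddCommGroup E]

/-- The norm of the gnomonic projection. -/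
noncomputable def gnomonicNorm (y : E) : ℝ := √(1 + ‖y‖ ^ 2)

theorem gnomonicNorm_pos (y : E) : 0 < gnomonicNorm y := Real.sqrt_pos.2 (by positivity)

variable [MeasurableSpace E] [BorelSpace E]

theorem measurable_gnomonicNorm : Measurable (gnomonicNorm : E → ℝ) := by
  unfold gnomonicNorm; fun_prop

variable [InnerProductSpace ℝ E] [FiniteDimensional ℝ E]

theorem lintegral_eq_setLIntegral_Ioi {h : ℝ → ENNReal} (hh : Measurable h) :
    ∫⁻ a, h a = ∫⁻ a in Set.Ioi 0, (h a + h (-a)) := by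
  have h1 := (Measure.measurePreserving_neg (volume : Measure ℝ)).setLIntegral_comp_preimage
    (measurableSet_Iio (a := (0 : ℝ))) hh
  have h2 : Neg.neg ⁻¹' Set.Iio (0 : ℝ) = Set.Ioi 0 := by ext; simp
  rw [h2] at h1
  rw [lintegral_add_left hh, h1, ← lintegral_add_compl h (measurableSet_Ioi (a := (0 : ℝ))),
    Set.compl_Ioi, setLIntegral_congr (Iio_ae_eq_Iic (a := (0 : ℝ)))]

theorem lintegral_comp_smul_pos {h : E → ENNReal} (hh : Measurable h) {a : ℝ} (ha : 0 < a) :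
    ∫⁻ x, h x = ENNReal.ofReal (a ^ Module.finrank ℝ E) * ∫⁻ y, h (a • y) := by
  rw [← lintegral_map (f := h) hh (measurable_const_smul a),
    Measure.map_addHaar_smul _ ha.ne', lintegral_smul_measure, smul_eq_mul, ← mul_assoc,
    ← ENNReal.ofReal_mul (by positivity), abs_of_pos (by positivity),
    mul_inv_cancel₀ (by positivity), ENNReal.ofReal_one, one_mul]

theorem setLIntegral_Ioo_pow (d : ℕ) {T : ℝ} (hT : 0 ≤ T) :
    ∫⁻ r in Set.Ioo 0 T, ENNReal.ofReal (r ^ d)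
      = ENNReal.ofReal (T ^ (d + 1)) * ENNReal.ofReal ((d : ℝ) + 1)⁻¹ := by
  rw [Measure.restrict_congr_set Ioo_ae_eq_Ioc,
    ← ofReal_integral_eq_lintegral_ofReal (intervalIntegral.intervalIntegrable_pow _).1,
    ← intervalIntegral.integral_of_le hT, ← ENNReal.ofReal_mul (by positivity)]
  · simp [div_eq_mul_inv]
  · filter_upwards [ae_restrict_mem measurableSet_Ioc] with y hy
    exact pow_nonneg hy.1.le _

variable {F : Type} [NormedAddCommGroup F] [InnerProductSpace ℝ F] [MeasurableSpace F]
  [BorelSpace F] [FiniteDimensional ℝ F]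

/-- An orthogonal decomposition of `F` into a coordinate axis and its complement `E`. -/
structure IsAxis (e : ℝ × E → F) : Prop where
  measurePreserving : MeasurePreserving e
  map_smul : ∀ (r : ℝ) p, e (r • p) = r • e p
  norm_sq : ∀ a x, ‖e (a, x)‖ ^ 2 = a ^ 2 + ‖x‖ ^ 2
  finrank : Module.finrank ℝ F = Module.finrank ℝ E + 1

variable {e : ℝ × E → F}

theorem IsAxis.lintegral_half (he : IsAxis e) {f : F → ENNReal} (hf : Measurable f) {σ : ℝ}
    (hσ : σ ^ 2 = 1) :
    ∫⁻ a in Set.Ioi 0, ∫⁻ x, (ball 0 1).indicator (fun p => f (‖p‖⁻¹ • p)) (e (a * σ, x))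
      = ∫⁻ y, ENNReal.ofReal ((gnomonicNorm y)⁻¹ ^ (Module.finrank ℝ E + 1))
        * f ((gnomonicNorm y)⁻¹ • e (σ, y)) * ENNReal.ofReal ((Module.finrank ℝ E : ℝ) + 1)⁻¹ := by
  have hem := he.measurePreserving.measurable
  have hg : Measurable ((ball (0 : F) 1).indicator (fun p => f (‖p‖⁻¹ • p))) :=
    Measurable.indicator (by fun_prop) measurableSet_ball
  have hgn := measurable_gnomonicNorm (E := E)
  have h1 : ∀ a ∈ Set.Ioi (0 : ℝ),
      ∫⁻ x, (ball 0 1).indicator (fun p => f (‖p‖⁻¹ • p)) (e (a * σ, x))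
        = ∫⁻ y, ENNReal.ofReal (a ^ Module.finrank ℝ E) *
          (ball 0 1).indicator (fun p => f (‖p‖⁻¹ • p)) (a • e (σ, y)) := by
    intro a ha
    rw [lintegral_comp_smul_pos (by fun_prop) ha, ← lintegral_const_mul _ (by fun_prop)]
    refine lintegral_congr fun y => ?_
    rw [← he.map_smul, Prod.smul_mk, smul_eq_mul]
  rw [setLIntegral_congr_fun measurableSet_Ioi h1, lintegral_lintegral_swap (by fun_prop)]
  refine lintegral_congr fun y => ?_
  have h0 := gnomonicNorm_pos y
  have hn : ‖e (σ, y)‖ = gnomonicNorm y := by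
    rw [gnomonicNorm, ← hσ, ← he.norm_sq, Real.sqrt_sq (norm_nonneg _)]
  rw [mul_right_comm, ← setLIntegral_Ioo_pow _ (inv_nonneg.2 h0.le),
    ← lintegral_mul_const _ (by fun_prop), ← lintegral_indicator measurableSet_Ioi,
    ← lintegral_indicator measurableSet_Ioo]
  refine lintegral_congr fun a => ?_
  by_cases ha : 0 < a
  · have hna : ‖a • e (σ, y)‖ = a * gnomonicNorm y := by
      rw [norm_smul, hn, Real.norm_of_nonneg ha.le]
    have hdir : ‖a • e (σ, y)‖⁻¹ • a • e (σ, y) = (gnomonicNorm y)⁻¹ • e (σ, y) := by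
      rw [hna, smul_smul]
      congr 1
      field_simp
    rw [Set.indicator_of_mem (Set.mem_Ioi.2 ha)]
    by_cases hT : a < (gnomonicNorm y)⁻¹
    · rw [Set.indicator_of_mem (Set.mem_Ioo.2 ⟨ha, hT⟩), Set.indicator_of_mem, hdir]
      rwa [mem_ball_zero_iff, hna, ← lt_inv_mul_iff₀' h0, mul_one]
    · rw [Set.indicator_of_notMem (s := Set.Ioo _ _) (fun h => hT h.2), Set.indicator_of_notMem,
        mul_zero]
      rwa [mem_ball_zero_iff, hna, ← lt_inv_mul_iff₀' h0, mul_one]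
  · rw [Set.indicator_of_notMem (s := Set.Ioi _) ha,
      Set.indicator_of_notMem (s := Set.Ioo _ _) (fun h => ha h.1)]

theorem IsAxis.lintegral_toSphere (he : IsAxis e) {f : F → ENNReal} (hf : Measurable f) :
    ∫⁻ u, f u ∂(volume : Measure F).toSphere
      = ∫⁻ y, ENNReal.ofReal ((gnomonicNorm y)⁻¹ ^ (Module.finrank ℝ E + 1))
        * (f ((gnomonicNorm y)⁻¹ • e (1, y)) + f ((gnomonicNorm y)⁻¹ • e (-1, y))) := by
  have : Nontrivial F := Module.finrank_pos_iff (R := ℝ).1 (by rw [he.finrank]; omega)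
  have hem := he.measurePreserving.measurable
  have hgn := measurable_gnomonicNorm (E := E)
  set κ := ENNReal.ofReal ((Module.finrank ℝ E : ℝ) + 1)⁻¹ with hκ
  have hκ0 : κ ≠ 0 := by rw [hκ, ne_eq, ENNReal.ofReal_eq_zero, not_le]; positivity
  have hκ1 : κ ≠ ⊤ := ENNReal.ofReal_ne_top
  set g := (ball (0 : F) 1).indicator (fun p => f (‖p‖⁻¹ • p)) with hgdef
  have hg : Measurable g := Measurable.indicator (by fun_prop) measurableSet_ball
  have h1 : ∫⁻ p, g p = (∫⁻ u, f u ∂(volume : Measure F).toSphere) * κ := by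
    rw [lintegral_eq_lintegral_toSphere hg, ← lintegral_mul_const _ (by fun_prop)]
    refine lintegral_congr fun u => ?_
    have hu : ‖(u : F)‖ = 1 := by simp
    have h2 := setLIntegral_Ioo_pow (Module.finrank ℝ E) zero_le_one
    rw [one_pow, ENNReal.ofReal_one, one_mul, ← hκ] at h2
    rw [← h2, ← lintegral_const_mul _ (by fun_prop), ← lintegral_indicator measurableSet_Ioi,
      ← lintegral_indicator measurableSet_Ioo]
    refine lintegral_congr fun a => ?_
    by_cases ha : 0 < a
    · have hna : ‖a • (u : F)‖ = a := by rw [norm_smul, hu, mul_one, Real.norm_of_nonneg ha.le]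
      rw [Set.indicator_of_mem (Set.mem_Ioi.2 ha), he.finrank, Nat.add_sub_cancel, hgdef]
      by_cases hT : a < 1
      · rw [Set.indicator_of_mem (Set.mem_Ioo.2 ⟨ha, hT⟩), Set.indicator_of_mem, hna, smul_smul,
          inv_mul_cancel₀ ha.ne', one_smul, mul_comm]
        rwa [mem_ball_zero_iff, hna]
      · rw [Set.indicator_of_notMem (s := Set.Ioo _ _) (fun h => hT h.2), Set.indicator_of_notMem,
        mul_zero]
        rwa [mem_ball_zero_iff, hna]
    · rw [Set.indicator_of_notMem (s := Set.Ioi _) ha,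
      Set.indicator_of_notMem (s := Set.Ioo _ _) (fun h => ha h.1)]
  have h3 : ∫⁻ p, g p = ∫⁻ a in Set.Ioi (0 : ℝ),
      ((∫⁻ x, g (e (a * 1, x))) + ∫⁻ x, g (e (a * -1, x))) := by
    rw [← he.measurePreserving.lintegral_comp hg]
    change ∫⁻ p : ℝ × E, g (e p) ∂(volume.prod volume) = _
    rw [lintegral_prod _ (by fun_prop),
      lintegral_eq_setLIntegral_Ioi
        (Measurable.lintegral_prod_right' (f := fun p : ℝ × E => g (e p)) (by fun_prop))]
    simp only [mul_one, mul_neg]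
  have h4 : Measurable fun a : ℝ => ∫⁻ x, g (e (a * 1, x)) :=
    Measurable.lintegral_prod_right' (f := fun p : ℝ × E => g (e (p.1 * 1, p.2))) (by fun_prop)
  rw [lintegral_add_left h4, he.lintegral_half hf (by norm_num), he.lintegral_half hf (by norm_num),
    ← lintegral_add_left (by fun_prop)] at h3
  refine (ENNReal.mul_left_inj hκ0 hκ1).1 ?_
  rw [← h1, h3, ← lintegral_mul_const _ (by fun_prop)]
  refine lintegral_congr fun y => ?_
  rw [← hκ]
  ring

end Gnomonic

section Projections

theorem image_orthographic : (fun r : ℝ => r / √(1 - r ^ 2)) '' Set.Ioo 0 1 = Set.Ioi 0 := by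
  ext t
  constructor
  · rintro ⟨r, hr, rfl⟩
    exact div_pos hr.1 (Real.sqrt_pos.2 (by nlinarith [hr.1, hr.2]))
  · intro (ht : 0 < t)
    have h0 : 0 < √(1 + t ^ 2) := Real.sqrt_pos.2 (by positivity)
    have h1 : √(1 + t ^ 2) ^ 2 = 1 + t ^ 2 := Real.sq_sqrt (by positivity)
    refine ⟨t / √(1 + t ^ 2), ⟨by positivity, (div_lt_one h0).2 (by nlinarith)⟩, ?_⟩
    have h2 : 1 - (t / √(1 + t ^ 2)) ^ 2 = (√(1 + t ^ 2))⁻¹ ^ 2 := by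
      rw [div_pow, inv_pow, h1]
      field_simp
      ring
    simp only [h2]
    rw [Real.sqrt_sq (by positivity)]
    field_simp

theorem injOn_orthographic : Set.InjOn (fun r : ℝ => r / √(1 - r ^ 2)) (Set.Ioo 0 1) := by
  intro r hr r' hr' h
  have h1 : 0 < 1 - r ^ 2 := by nlinarith [hr.1, hr.2]
  have h1' : 0 < 1 - r' ^ 2 := by nlinarith [hr'.1, hr'.2]
  have h2 : (r / √(1 - r ^ 2)) ^ 2 = (r' / √(1 - r' ^ 2)) ^ 2 := congrArg (· ^ 2) h
  rw [div_pow, div_pow, Real.sq_sqrt h1.le, Real.sq_sqrt h1'.le, div_eq_div_iff h1.ne' h1'.ne'] at h2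
  exact (pow_left_inj₀ hr.1.le hr'.1.le two_ne_zero).1 (by linarith)

theorem hasDerivAt_orthographic {r : ℝ} (hr : r ∈ Set.Ioo (0 : ℝ) 1) :
    HasDerivAt (fun r : ℝ => r / √(1 - r ^ 2)) ((√(1 - r ^ 2))⁻¹ ^ 3) r := by
  have h1 : 0 < 1 - r ^ 2 := by nlinarith [hr.1, hr.2]
  have h2 := Real.sqrt_pos.2 h1
  have h3 : √(1 - r ^ 2) ^ 2 = 1 - r ^ 2 := Real.sq_sqrt h1.le
  have h4 : HasDerivAt (fun r : ℝ => 1 - r ^ 2) (-(2 * r)) r := by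
    simpa using (hasDerivAt_pow 2 r).const_sub 1
  refine ((hasDerivAt_id r).div (h4.sqrt h1.ne') h2.ne').congr_deriv ?_
  simp only [id]
  field_simp
  rw [h3]
  ring

/-- The radii which the radial part `r ↦ σ * r / (1 - r ^ 2 / 4)` of the transition between the
stereographic and the gnomonic projection maps to positive radii. -/
def stereoRadii (σ : ℝ) : Set ℝ := {r | 0 < r ∧ 0 < σ * (1 - r ^ 2 / 4)}

theorem measurableSet_stereoRadii (σ : ℝ) : MeasurableSet (stereoRadii σ) :=
  measurableSet_Ioi.inter 
    (measurableSet_lt measurable_const (by fun_prop : Measurable fun r : ℝ => σ * (1 - r ^ 2 / 4)))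

theorem one_sub_ne_zero_of_mem_stereoRadii {σ r : ℝ} (hr : r ∈ stereoRadii σ) :
    1 - r ^ 2 / 4 ≠ 0 := right_ne_zero_of_mul hr.2.ne'

theorem image_stereographic {σ : ℝ} (hσ : σ ^ 2 = 1) :
    (fun r : ℝ => σ * r / (1 - r ^ 2 / 4)) '' stereoRadii σ = Set.Ioi 0 := by
  ext t
  constructor
  · rintro ⟨r, hr, rfl⟩
    have h1 := one_sub_ne_zero_of_mem_stereoRadii hr
    have h2 : σ * r / (1 - r ^ 2 / 4) = σ * (1 - r ^ 2 / 4) * r / (1 - r ^ 2 / 4) ^ 2 := by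
      field_simp
    have := mul_pos hr.2 hr.1
    simp only [Set.mem_Ioi, h2]
    positivity
  · intro (ht : 0 < t)
    have h1 : √(1 + t ^ 2) ^ 2 = 1 + t ^ 2 := Real.sq_sqrt (by positivity)
    have h2 : σ < √(1 + t ^ 2) := Real.lt_sqrt_of_sq_lt (by nlinarith)
    set r := 2 * (√(1 + t ^ 2) - σ) / t with hr
    have hr0 : 0 < r := div_pos (by linarith) ht
    have h3 : t * (1 - r ^ 2 / 4) = σ * r := by
      rw [hr]
      field_simp
      linear_combination 4 * hσ - 4 * h1
    have h4 : σ * (1 - r ^ 2 / 4) = r / t := by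
      rw [eq_div_iff ht.ne']
      linear_combination σ * h3 + r * hσ
    have hmem : r ∈ stereoRadii σ := ⟨hr0, by rw [h4]; positivity⟩
    exact ⟨r, hmem, (div_eq_iff (one_sub_ne_zero_of_mem_stereoRadii hmem)).2 h3.symm⟩

theorem injOn_stereographic {σ : ℝ} (hσ : σ ^ 2 = 1) :
    Set.InjOn (fun r : ℝ => σ * r / (1 - r ^ 2 / 4)) (stereoRadii σ) := by
  intro r hr r' hr' h
  have h1 := one_sub_ne_zero_of_mem_stereoRadii hr
  have h1' := one_sub_ne_zero_of_mem_stereoRadii hr'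
  have h2 : σ * r * (1 - r' ^ 2 / 4) = σ * r' * (1 - r ^ 2 / 4) := (div_eq_div_iff h1 h1').1 h
  have h3 : (r - r') * (1 + r * r' / 4) = 0 := by
    linear_combination σ * h2 - (r * (1 - r' ^ 2 / 4) - r' * (1 - r ^ 2 / 4)) * hσ
  have h4 : 0 < 1 + r * r' / 4 := by have := mul_pos hr.1 hr'.1; positivity
  exact sub_eq_zero.1 ((mul_eq_zero.1 h3).resolve_right h4.ne')

theorem hasDerivAt_stereographic {σ r : ℝ} (hr : r ∈ stereoRadii σ) :
    HasDerivAt (fun r : ℝ => σ * r / (1 - r ^ 2 / 4))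
      (σ * (1 + r ^ 2 / 4) / (1 - r ^ 2 / 4) ^ 2) r := by
  have h1 := one_sub_ne_zero_of_mem_stereoRadii hr
  have h2 : HasDerivAt (fun r : ℝ => σ * r) σ r := by
    simpa using (hasDerivAt_id r).const_mul σ
  have h4 : HasDerivAt (fun r : ℝ => 1 - r ^ 2 / 4) (-(2 * r / 4)) r := by
    simpa using ((hasDerivAt_pow 2 r).div_const 4).const_sub 1
  refine (h2.div h4 h1).congr_deriv ?_
  congr 1
  ring

variable {E : Type} [NormedAddCommGroup E] [InnerProductSpace ℝ E] [MeasurableSpace E]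
  [BorelSpace E] [FiniteDimensional ℝ E]
variable {F : Type} [NormedAddCommGroup F] [InnerProductSpace ℝ F] [MeasurableSpace F]
  [BorelSpace F] [FiniteDimensional ℝ F] {e : ℝ × E → F}

/-- The surface measure in orthographic projection along an axis. -/
theorem IsAxis.lintegral_toSphere_orthographic [Nontrivial E] (he : IsAxis e) {f : F → ENNReal}
    (hf : Measurable f) :
    ∫⁻ u, f u ∂(volume : Measure F).toSphere
      = ∫⁻ x, ENNReal.ofReal (height 1 x)⁻¹
        * (f (e (height 1 x, x)) + f (e (-height 1 x, x))) := by
  have hem := he.measurePreserving.measurable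
  have hgn := measurable_gnomonicNorm (E := E)
  have hms : MeasurableSet {x : E | ‖x‖ ∈ Set.Ioo (0 : ℝ) 1} := measurable_norm measurableSet_Ioo
  have hd : 0 < Module.finrank ℝ E := Module.finrank_pos
  rw [he.lintegral_toSphere hf, setLIntegral_radial measurableSet_Ioo (fun r hr => hr.1)
    (fun r hr => hasDerivAt_orthographic hr) injOn_orthographic image_orthographic (by fun_prop)
    (by fun_prop) (by fun_prop), ← lintegral_indicator hms]
  refine lintegral_congr_ae ?_
  filter_upwards [compl_mem_ae_iff.2 (measure_singleton (0 : E))] with x hx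
  have hx0 : 0 < ‖x‖ := norm_pos_iff.2 hx
  by_cases h1 : ‖x‖ < 1
  · rw [Set.indicator_of_mem (show x ∈ {x : E | ‖x‖ ∈ Set.Ioo (0 : ℝ) 1} from ⟨hx0, h1⟩)]
    have hh := height_pos h1
    have hsq := sq_height h1
    have hdef : √(1 - ‖x‖ ^ 2) = height 1 x := by rw [height, one_pow]
    have h2 : ‖x‖ / height 1 x / ‖x‖ = (height 1 x)⁻¹ := by field_simp
    have h3 : gnomonicNorm ((height 1 x)⁻¹ • x) = (height 1 x)⁻¹ := by
      rw [gnomonicNorm, norm_smul, norm_inv, Real.norm_of_nonneg hh.le,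
        Real.sqrt_eq_iff_mul_self_eq (by positivity) (by positivity)]
      field_simp
      linarith
    have h4 (σ : ℝ) : height 1 x • e (σ, (height 1 x)⁻¹ • x) = e (height 1 x * σ, x) := by
      rw [← he.map_smul, Prod.smul_mk, smul_smul, mul_inv_cancel₀ hh.ne', one_smul, smul_eq_mul]
    rw [hdef, h2, h3, inv_inv, h4, h4, mul_one, mul_neg_one, ← mul_assoc,
      ← ENNReal.ofReal_mul (by positivity)]
    congr 2
    obtain ⟨d, hd⟩ : ∃ d, Module.finrank ℝ E = d + 1 := ⟨_, (Nat.succ_pred_eq_of_pos hd).symm⟩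
    rw [hd, Nat.add_sub_cancel, abs_of_pos (by positivity)]
    simp only [inv_pow]
    field_simp
    ring
  · rw [Set.indicator_of_notMem (fun h => h1 h.2), height_eq_zero zero_le_one (not_lt.1 h1)]
    simp

/-- The inverse of the stereographic projection along an axis, from the sphere of diameter `2`. -/
noncomputable def invStereo (e : ℝ × E → F) (z : E) : F :=
  (1 + ‖z‖ ^ 2 / 4)⁻¹ • e (1 - ‖z‖ ^ 2 / 4, z)

theorem IsAxis.measurable_invStereo (he : IsAxis e) : Measurable (invStereo e) := by
  have hem := he.measurePreserving.measurable
  unfold invStereo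
  fun_prop

theorem IsAxis.lintegral_stereographic_half [Nontrivial E] (he : IsAxis e) {f : F → ENNReal}
    (hf : Measurable f) {σ : ℝ} (hσ : σ ^ 2 = 1) :
    ∫⁻ y, ENNReal.ofReal ((gnomonicNorm y)⁻¹ ^ (Module.finrank ℝ E + 1))
        * f ((gnomonicNorm y)⁻¹ • e (σ, y))
      = ∫⁻ z in {z : E | ‖z‖ ∈ stereoRadii σ},
        ENNReal.ofReal ((1 + ‖z‖ ^ 2 / 4)⁻¹ ^ Module.finrank ℝ E) * f (invStereo e z) := by
  have hem := he.measurePreserving.measurable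
  have hgn := measurable_gnomonicNorm (E := E)
  have hd : 0 < Module.finrank ℝ E := Module.finrank_pos
  rw [setLIntegral_radial (measurableSet_stereoRadii σ) (fun r hr => hr.1)
    (fun r hr => hasDerivAt_stereographic hr) (injOn_stereographic hσ) (image_stereographic hσ)
    (by fun_prop) (by fun_prop) (by fun_prop)]
  refine setLIntegral_congr_fun (measurable_norm (measurableSet_stereoRadii σ)) fun z hz => ?_
  have hz0 : 0 < ‖z‖ := hz.1
  have hq := hz.2
  have hq0 := one_sub_ne_zero_of_mem_stereoRadii hz
  set q := ‖z‖ ^ 2 / 4 with hqdef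
  have hq1 : 0 < 1 + q := by positivity
  have hσ0 : σ ≠ 0 := left_ne_zero_of_mul hq.ne'
  have h2 : σ * ‖z‖ / (1 - q) / ‖z‖ = (σ * (1 - q))⁻¹ := by
    field_simp
    linear_combination hσ
  have h3 : gnomonicNorm ((σ * (1 - q))⁻¹ • z) = (1 + q) * (σ * (1 - q))⁻¹ := by
    rw [gnomonicNorm, norm_smul, norm_inv, Real.norm_of_nonneg hq.le,
      Real.sqrt_eq_iff_mul_self_eq (by positivity) (by positivity)]
    have : ‖z‖ ^ 2 = 4 * q := by rw [hqdef]; ring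
    field_simp
    rw [this]
    linear_combination (1 - q) ^ 2 * hσ
  have h4 : ((1 + q) * (σ * (1 - q))⁻¹)⁻¹ • e (σ, (σ * (1 - q))⁻¹ • z) = invStereo e z := by
    rw [invStereo, mul_inv, inv_inv, mul_smul, ← he.map_smul (σ * (1 - q)), Prod.smul_mk, smul_smul,
      mul_inv_cancel₀ hq.ne', one_smul, smul_eq_mul, ← hqdef]
    congr 3
    linear_combination (1 - q) * hσ
  rw [h2, h3, h4, ← mul_assoc, ← ENNReal.ofReal_mul (by positivity)]
  congr 2
  obtain ⟨d, hd⟩ : ∃ d, Module.finrank ℝ E = d + 1 := ⟨_, (Nat.succ_pred_eq_of_pos hd).symm⟩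
  have habs : |σ| = 1 := (pow_left_inj₀ (abs_nonneg σ) zero_le_one two_ne_zero).1
    (by rw [sq_abs, hσ, one_pow])
  have h5 : |σ * (1 + q) / (1 - q) ^ 2| = (1 + q) * (σ * (1 - q))⁻¹ ^ 2 := by
    rw [abs_div, abs_mul, abs_of_pos hq1, abs_of_pos (by positivity : 0 < (1 - q) ^ 2),
      habs, inv_pow, mul_pow, hσ, one_mul, one_mul, div_eq_mul_inv]
  rw [hd, Nat.add_sub_cancel, h5]
  generalize σ * (1 - q) = a at hq
  simp only [mul_pow, mul_inv, inv_inv, inv_pow]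
  field_simp
  ring

/-- The surface measure in stereographic projection along an axis. -/
theorem IsAxis.lintegral_toSphere_stereographic [Nontrivial E] (he : IsAxis e) {f : F → ENNReal}
    (hf : Measurable f) :
    ∫⁻ u, f u ∂(volume : Measure F).toSphere
      = ∫⁻ z, ENNReal.ofReal ((1 + ‖z‖ ^ 2 / 4)⁻¹ ^ Module.finrank ℝ E) * f (invStereo e z) := by
  have hem := he.measurePreserving.measurable
  have hgn := measurable_gnomonicNorm (E := E)
  have hms (σ : ℝ) : MeasurableSet {z : E | ‖z‖ ∈ stereoRadii σ} :=
    measurable_norm (measurableSet_stereoRadii σ)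
  rw [he.lintegral_toSphere hf]
  simp only [mul_add]
  rw [lintegral_add_left (by fun_prop), he.lintegral_stereographic_half hf (by norm_num),
    he.lintegral_stereographic_half hf (by norm_num), ← lintegral_union (hms _)]
  · nth_rw 2 [← Measure.restrict_univ (μ := (volume : Measure E))]
    refine setLIntegral_congr (eventuallyEq_univ.2 ?_)
    filter_upwards [compl_mem_ae_iff.2 (measure_singleton (0 : E)),
      compl_mem_ae_iff.2 (Measure.addHaar_sphere volume (0 : E) 2)] with z hz hz2
    have hz0 : 0 < ‖z‖ := norm_pos_iff.2 hz
    have hne : ‖z‖ ≠ 2 := fun h => hz2 (by simpa using h)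
    rcases hne.lt_or_gt with h | h
    · exact Or.inl ⟨hz0, by nlinarith⟩
    · exact Or.inr ⟨hz0, by nlinarith⟩
  · rw [Set.disjoint_left]
    intro z h1 h2
    have := h1.2
    have := h2.2
    linarith

end Projections

section Bochner

variable {E : Type} [NormedAddCommGroup E] [InnerProductSpace ℝ E] [MeasurableSpace E]
  [BorelSpace E] [FiniteDimensional ℝ E] [Nontrivial E]
variable {F : Type} [NormedAddCommGroup F] [InnerProductSpace ℝ F] [MeasurableSpace F]
  [BorelSpace F] [FiniteDimensional ℝ F] {e : ℝ × E → F}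

theorem IsAxis.map_toSphere_stereographic (he : IsAxis e) :
    (volume : Measure F).toSphere.map (↑) = ((volume : Measure E).withDensity fun z =>
      ENNReal.ofReal ((1 + ‖z‖ ^ 2 / 4)⁻¹ ^ Module.finrank ℝ E)).map (invStereo e) := by
  have hΨ := he.measurable_invStereo
  refine Measure.ext_of_lintegral _ fun f hf => ?_
  rw [lintegral_map hf (by fun_prop), lintegral_map hf hΨ,
    lintegral_withDensity_eq_lintegral_mul _ (by fun_prop) (by fun_prop),
    he.lintegral_toSphere_stereographic hf]
  rfl

theorem IsAxis.integral_toSphere_stereographic (he : IsAxis e) {f : F → ℂ} (hf : Measurable f) :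
    ∫ u, f u ∂(volume : Measure F).toSphere
      = ∫ z, ((1 + ‖z‖ ^ 2 / 4)⁻¹ ^ Module.finrank ℝ E) • f (invStereo e z) := by
  have hΨ := he.measurable_invStereo
  rw [← integral_map (φ := ((↑) : sphere (0 : F) 1 → F)) (by fun_prop) hf.aestronglyMeasurable,
    he.map_toSphere_stereographic, integral_map (by fun_prop) hf.aestronglyMeasurable,
    integral_withDensity_eq_integral_toReal_smul (by fun_prop) (by simp)]
  refine integral_congr_ae (.of_forall fun z => ?_)
  simp only
  rw [ENNReal.toReal_ofReal (by positivity)]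

theorem IsAxis.map_toSphere_orthographic (he : IsAxis e) :
    (volume : Measure F).toSphere.map (↑) =
      ((volume : Measure E).withDensity fun x => ENNReal.ofReal (height 1 x)⁻¹).map
        (fun x => e (height 1 x, x)) +
      ((volume : Measure E).withDensity fun x => ENNReal.ofReal (height 1 x)⁻¹).map
        (fun x => e (-height 1 x, x)) := by
  have hem := he.measurePreserving.measurable
  have hh := (continuous_height (E := E) 1).measurable
  refine Measure.ext_of_lintegral _ fun f hf => ?_
  rw [lintegral_map hf (by fun_prop), lintegral_add_measure, lintegral_map hf (by fun_prop),
    lintegral_map hf (by fun_prop),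
    lintegral_withDensity_eq_lintegral_mul _ (by fun_prop) (by fun_prop),
    lintegral_withDensity_eq_lintegral_mul _ (by fun_prop) (by fun_prop),
    he.lintegral_toSphere_orthographic hf, ← lintegral_add_left (by fun_prop)]
  simp only [mul_add, Pi.mul_apply]

theorem IsAxis.integral_toSphere_orthographic (he : IsAxis e) {f : F → ℂ} (hf : Measurable f)
    (hint : Integrable (fun u : sphere (0 : F) 1 => f u) (volume : Measure F).toSphere) :
    ∫ u, f u ∂(volume : Measure F).toSphere = ∫ x, sheets 1 (fun p => f (e (p.2, p.1))) x := by
  have hem := he.measurePreserving.measurable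
  have hh := (continuous_height (E := E) 1).measurable
  have hint' : Integrable f ((volume : Measure F).toSphere.map (↑)) :=
    (integrable_map_measure hf.aestronglyMeasurable (by fun_prop)).2 hint
  rw [he.map_toSphere_orthographic, integrable_add_measure] at hint'
  have hhalf {s : E → F} (hs : Measurable s) (hi : Integrable f
      (((volume : Measure E).withDensity fun x => ENNReal.ofReal (height 1 x)⁻¹).map s)) :
      Integrable (fun x => (height 1 x : ℂ)⁻¹ * f (s x)) ∧ ∫ y, f y
        ∂(((volume : Measure E).withDensity fun x => ENNReal.ofReal (height 1 x)⁻¹).map s)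
        = ∫ x, (height 1 x : ℂ)⁻¹ * f (s x) := by
    have heq : (fun x => (ENNReal.ofReal (height 1 x)⁻¹).toReal • f (s x))
        = fun x => (height 1 x : ℂ)⁻¹ * f (s x) := by
      ext x
      rw [ENNReal.toReal_ofReal (inv_nonneg.2 (height_nonneg _ _)), Complex.real_smul,
        Complex.ofReal_inv]
    rw [integrable_map_measure hf.aestronglyMeasurable hs.aemeasurable,
      integrable_withDensity_iff_integrable_smul' (by fun_prop) (by simp)] at hi
    rw [integral_map hs.aemeasurable hf.aestronglyMeasurable,
      integral_withDensity_eq_integral_toReal_smul (by fun_prop) (by simp), heq]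
    simp only [Function.comp_apply, heq] at hi
    exact ⟨hi, rfl⟩
  have h1 := hhalf (by fun_prop) hint'.1
  have h2 := hhalf (by fun_prop) hint'.2
  rw [← integral_map (φ := ((↑) : sphere (0 : F) 1 → F)) (by fun_prop) hf.aestronglyMeasurable,
    he.map_toSphere_orthographic, integral_add_measure hint'.1 hint'.2, h1.2, h2.2,
    ← integral_add h1.1 h2.1]
  simp only [sheets, mul_add]

end Bochner

section Coordinates

/-- The decomposition of Euclidean space into the `j`-th coordinate axis and its complement. -/
noncomputable def insertCoord {n : ℕ} (j : Fin (n + 1)) (p : ℝ × EuclideanSpace ℝ (Fin n)) :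
    EuclideanSpace ℝ (Fin (n + 1)) :=
  WithLp.toLp 2 (j.insertNth p.1 p.2)

@[simp] theorem insertCoord_self {n : ℕ} (j : Fin (n + 1)) (p : ℝ × EuclideanSpace ℝ (Fin n)) :
    insertCoord j p j = p.1 := by simp [insertCoord]

@[simp] theorem insertCoord_succAbove {n : ℕ} (j : Fin (n + 1))
    (p : ℝ × EuclideanSpace ℝ (Fin n)) (i : Fin n) :
    insertCoord j p (j.succAbove i) = p.2 i := by simp [insertCoord]

theorem inner_insertCoord {n : ℕ} (j : Fin (n + 1)) (p q : ℝ × EuclideanSpace ℝ (Fin n)) :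
    inner ℝ (insertCoord j p) (insertCoord j q) = p.1 * q.1 + inner ℝ p.2 q.2 := by
  simp only [PiLp.inner_apply, Fin.sum_univ_succAbove _ j, insertCoord_self, insertCoord_succAbove]
  simp [mul_comm]

theorem isAxis_insertCoord {n : ℕ} (j : Fin (n + 1)) : IsAxis (insertCoord j) where
  measurePreserving := by
    have h1 := (MeasurePreserving.id (volume : Measure ℝ)).prod (PiLp.volume_preserving_ofLp (Fin n))
    have h2 := (volume_preserving_piFinSuccAbove (fun _ : Fin (n + 1) => ℝ) j).symm
    exact (PiLp.volume_preserving_toLp (Fin (n + 1))).comp (h2.comp h1)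
  map_smul r p := by
    ext i
    refine Fin.succAboveCases j ?_ (fun i => ?_) i <;> simp
  norm_sq a x := by
    rw [← real_inner_self_eq_norm_sq, inner_insertCoord, real_inner_self_eq_norm_sq]; ring
  finrank := by simp

end Coordinates

section Hemisphere

variable {n : ℕ}

/-- The point of Euclidean space with the first coordinate dropped. -/
noncomputable def dropFirst (x : EuclideanSpace ℝ (Fin (n + 1))) : EuclideanSpace ℝ (Fin n) :=
  WithLp.toLp 2 fun i => x i.succ

@[simp] theorem dropFirst_apply (x : EuclideanSpace ℝ (Fin (n + 1))) (i : Fin n) :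
    dropFirst x i = x i.succ := rfl

@[fun_prop] theorem continuous_dropFirst :
    Continuous (dropFirst : EuclideanSpace ℝ (Fin (n + 1)) → EuclideanSpace ℝ (Fin n)) := by
  unfold dropFirst; fun_prop

@[simp] theorem dropFirst_insertCoord_zero (p : ℝ × EuclideanSpace ℝ (Fin n)) :
    dropFirst (insertCoord 0 p) = p.2 := by
  ext i
  simpa using insertCoord_succAbove 0 p i

@[simp] theorem insertCoord_zero_dropFirst (x : EuclideanSpace ℝ (Fin (n + 1))) :
    insertCoord 0 (x 0, dropFirst x) = x := by
  ext i
  refine Fin.cases (by simp) (fun i => ?_) i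
  simpa using insertCoord_succAbove 0 (x 0, dropFirst x) i

/-- The open half-spaces of the equatorial plane cut out by half-spaces parallel to the first axis. -/
noncomputable def equatorialConstraints (S : Finset (EuclideanSpace ℝ (Fin (n + 1)) × ℝ)) :
    List (EuclideanSpace ℝ (Fin n) × ℝ) :=
  S.toList.map fun p => (dropFirst p.1, p.2)

theorem IsSphericalDHPolytope.isClosed {P : Set (EuclideanSpace ℝ (Fin (n + 1)))}
    (hP : IsSphericalDHPolytope n P) : IsClosed P := by
  obtain ⟨S, -, rfl⟩ := hP
  refine isClosed_sphere.inter (isClosed_biInter fun p _ => ?_)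
  exact isClosed_le continuous_const (by fun_prop)

theorem ae_mem_iff_mem_polyhedron {S : Finset (EuclideanSpace ℝ (Fin (n + 1)) × ℝ)}
    (hS : ∀ p ∈ S, p.1 ≠ 0 ∧ p.1 0 = 0) :
    ∀ᵐ x : EuclideanSpace ℝ (Fin n), ∀ a : ℝ,
      (insertCoord 0 (a, x) ∈ ⋂ p ∈ S, {x | p.2 ≤ inner ℝ p.1 x}) ↔
        x ∈ polyhedron (equatorialConstraints S) := by
  have h1 : ∀ p ∈ S, ∀ a x, inner ℝ p.1 (insertCoord 0 (a, x)) = inner ℝ (dropFirst p.1) x := by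
    intro p hp a x
    conv_lhs => rw [← insertCoord_zero_dropFirst p.1]
    simp [inner_insertCoord, (hS p hp).2]
  have h2 : ∀ p ∈ S, ∀ᵐ x, inner ℝ (dropFirst p.1) x ≠ p.2 := by
    intro p hp
    refine measure_mono_null (fun x hx => not_not.1 hx) (volume_hyperplane (fun h => ?_) p.2)
    refine (hS p hp).1 ?_
    rw [← insertCoord_zero_dropFirst p.1, h, (hS p hp).2]
    ext i
    refine Fin.cases (by simp) (fun i => ?_) i
    simpa using insertCoord_succAbove 0 ((0 : ℝ), (0 : EuclideanSpace ℝ (Fin n))) i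
  filter_upwards [(ae_ball_iff S.countable_toSet).2 h2] with x hx a
  simp only [Set.mem_iInter, Set.mem_ofPred_eq, polyhedron, equatorialConstraints, List.mem_map,
    Finset.mem_toList, forall_exists_index, and_imp, forall_apply_eq_imp_iff₂]
  refine forall₂_congr fun p hp => ?_
  rw [h1 p hp]
  exact ⟨fun h => h.lt_of_ne' (hx p hp), le_of_lt⟩

/-- The integrand `(x₀ - ε c i)⁻ⁿ` with the regularization varying over the equatorial plane. -/
noncomputable def hemisphereDensity (c : EuclideanSpace ℝ (Fin n) → ℝ) (ε : ℝ)
    (x : EuclideanSpace ℝ (Fin (n + 1))) : ℂ :=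
  ((x 0 : ℂ) - (ε * c (dropFirst x) : ℝ) * Complex.I) ^ (-(n : ℤ))

theorem measurable_hemisphereDensity {c : EuclideanSpace ℝ (Fin n) → ℝ} (hc : Measurable c)
    (ε : ℝ) : Measurable (hemisphereDensity c ε) := by
  unfold hemisphereDensity
  simp only [zpow_neg, zpow_natCast]
  have : Measurable fun x : EuclideanSpace ℝ (Fin (n + 1)) => c (dropFirst x) :=
    hc.comp continuous_dropFirst.measurable
  have h0 : Measurable fun x : EuclideanSpace ℝ (Fin (n + 1)) => x 0 := by fun_prop
  fun_prop

theorem norm_hemisphereDensity_le {c : EuclideanSpace ℝ (Fin n) → ℝ} {c₀ ε : ℝ} (hc₀ : 0 < c₀)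
    (hc : ∀ x, c₀ ≤ c x) (hε : 0 < ε) (x : EuclideanSpace ℝ (Fin (n + 1))) :
    ‖hemisphereDensity c ε x‖ ≤ ((ε * c₀) ^ n)⁻¹ := by
  rw [hemisphereDensity, zpow_neg, zpow_natCast, norm_inv, norm_pow]
  have h : ε * c₀ ≤ ‖(x 0 : ℂ) - (ε * c (dropFirst x) : ℝ) * Complex.I‖ := by
    refine le_trans ?_ (Complex.abs_im_le_norm _)
    simp only [Complex.sub_im, Complex.ofReal_im, Complex.mul_im, Complex.I_re, Complex.I_im,
      Complex.ofReal_re, mul_zero, mul_one, zero_sub, add_zero, abs_neg]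
    exact (mul_le_mul_of_nonneg_left (hc _) hε.le).trans (le_abs_self _)
  gcongr

theorem hemisphereDensity_insertCoord (hn : 1 ≤ n) (c : EuclideanSpace ℝ (Fin n) → ℝ) (ε σ : ℝ)
    (x : EuclideanSpace ℝ (Fin n)) :
    hemisphereDensity c ε (insertCoord 0 (σ, x)) = Complex.I ^ n * regKernel c n ε (x, σ) := by
  obtain ⟨m, rfl⟩ := Nat.exists_eq_add_of_le' hn
  rw [hemisphereDensity, insertCoord_self, dropFirst_insertCoord_zero, regKernel, kernel,
    zpow_neg, zpow_natCast, ← inv_pow, ← inv_pow, ← mul_pow]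
  congr 1
  rw [← inv_inv Complex.I, ← mul_inv, inv_inv, Complex.inv_I, regHeight]
  congr 1
  linear_combination (σ : ℂ) * Complex.I_sq

theorem setIntegral_hemisphereDensity (hn : 1 ≤ n)
    {S : Finset (EuclideanSpace ℝ (Fin (n + 1)) × ℝ)} (hS : ∀ p ∈ S, p.1 ≠ 0 ∧ p.1 0 = 0)
    {P : Set (EuclideanSpace ℝ (Fin (n + 1)))}
    (hP : P = sphere (0 : EuclideanSpace ℝ (Fin (n + 1))) 1 ∩ ⋂ p ∈ S, {x | p.2 ≤ inner ℝ p.1 x})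
    {c : EuclideanSpace ℝ (Fin n) → ℝ} (hc : IsRegularization c) {ε : ℝ} (hε : 0 < ε) :
    ∫ x in (Subtype.val ⁻¹' P : Set (sphere (0 : EuclideanSpace ℝ (Fin (n + 1))) 1)),
        hemisphereDensity c ε x ∂(sphereMeasure n) =
      sphericalIntegral (polyhedron (equatorialConstraints S)) 1 (fun _ => Complex.I ^ n) c n ε := by
  have : Nontrivial (EuclideanSpace ℝ (Fin n)) :=
    Module.nontrivial_of_finrank_pos (R := ℝ) (by simpa using Nat.pos_of_ne_zero (by omega))
  have hPm : MeasurableSet P := IsClosed.measurableSet (IsSphericalDHPolytope.isClosed ⟨S, hS, hP⟩)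
  obtain ⟨hcs, c₀, hc₀, hcc⟩ := hc
  have hf : Measurable (P.indicator (hemisphereDensity c ε)) :=
    (measurable_hemisphereDensity hcs.continuous.measurable ε).indicator hPm
  have hint : Integrable (fun u : sphere (0 : EuclideanSpace ℝ (Fin (n + 1))) 1 =>
      P.indicator (hemisphereDensity c ε) u) (volume : Measure _).toSphere := by
    refine Integrable.of_bound (hf.comp measurable_subtype_coe).aestronglyMeasurable
      ((ε * c₀) ^ n)⁻¹ (ae_of_all _ fun u => ?_)
    exact (norm_indicator_le_norm_self _ _).trans (norm_hemisphereDensity_le hc₀ hcc hε _)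
  rw [← integral_indicator (measurable_subtype_coe hPm), sphericalIntegral,
    ← integral_indicator (measurableSet_polyhedron _)]
  refine ((isAxis_insertCoord 0).integral_toSphere_orthographic hf hint).trans
    (integral_congr_ae ?_)
  filter_upwards [ae_mem_iff_mem_polyhedron hS] with x hx
  rcases le_or_gt 1 ‖x‖ with h1 | h1
  · rw [sheets_eq_zero zero_le_one h1]
    by_cases h : x ∈ polyhedron (equatorialConstraints S)
    · rw [Set.indicator_of_mem h, sheets_eq_zero zero_le_one h1]
    · rw [Set.indicator_of_notMem h]
  · have hmem : ∀ σ : ℝ, σ ^ 2 = 1 - ‖x‖ ^ 2 →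
        (insertCoord 0 (σ, x) ∈ P ↔ x ∈ polyhedron (equatorialConstraints S)) := by
      intro σ hσ
      have hs : insertCoord 0 (σ, x) ∈ sphere (0 : EuclideanSpace ℝ (Fin (n + 1))) 1 := by
        rw [mem_sphere_zero_iff_norm, ← sq_eq_sq₀ (norm_nonneg _) zero_le_one,
          (isAxis_insertCoord 0).norm_sq, hσ]
        ring
      rw [hP, Set.mem_inter_iff, hx]
      exact and_iff_right hs
    have h2 : height 1 x ^ 2 = 1 - ‖x‖ ^ 2 := by rw [sq_height h1, one_pow]
    have h3 : (-height 1 x) ^ 2 = 1 - ‖x‖ ^ 2 := by rw [neg_sq, h2]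
    by_cases h : x ∈ polyhedron (equatorialConstraints S)
    · simp only [Set.indicator_of_mem h, sheets, Set.indicator_of_mem ((hmem _ h2).2 h),
        Set.indicator_of_mem ((hmem _ h3).2 h), hemisphereDensity_insertCoord hn]
    · simp only [Set.indicator_of_notMem h, sheets, add_zero, mul_zero,
        Set.indicator_of_notMem (mt (hmem _ h2).1 h), Set.indicator_of_notMem (mt (hmem _ h3).1 h)]

end Hemisphere

section HalfSpace

variable {n : ℕ}

theorem invStereo_last (z : EuclideanSpace ℝ (Fin n)) :
    invStereo (insertCoord (Fin.last n)) z (Fin.last n) =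
      (1 + ‖z‖ ^ 2 / 4)⁻¹ * (1 - ‖z‖ ^ 2 / 4) := by
  simp [invStereo]

theorem invStereo_castSucc (z : EuclideanSpace ℝ (Fin n)) (j : Fin n) :
    invStereo (insertCoord (Fin.last n)) z j.castSucc = (1 + ‖z‖ ^ 2 / 4)⁻¹ * z j := by
  have := insertCoord_succAbove (Fin.last n) (1 - ‖z‖ ^ 2 / 4, z) j
  rw [Fin.succAbove_last] at this
  simp [invStereo, this]

theorem one_add_invStereo_last (z : EuclideanSpace ℝ (Fin n)) :
    1 + invStereo (insertCoord (Fin.last n)) z (Fin.last n) = 2 * (1 + ‖z‖ ^ 2 / 4)⁻¹ := by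
  have : (1 + ‖z‖ ^ 2 / 4) ≠ 0 := by positivity
  rw [invStereo_last]
  field_simp
  ring

theorem invStereo_stereographic {x : EuclideanSpace ℝ (Fin (n + 1))} (hx : ‖x‖ = 1)
    (hl : 0 < 1 + x (Fin.last n)) {z : EuclideanSpace ℝ (Fin n)}
    (hz : ∀ j, z j = 2 * x j.castSucc / (1 + x (Fin.last n))) :
    invStereo (insertCoord (Fin.last n)) z = x := by
  have h1 : (∑ j : Fin n, x j.castSucc ^ 2) + x (Fin.last n) ^ 2 = 1 := by
    rw [← Fin.sum_univ_castSucc fun i => x i ^ 2, ← EuclideanSpace.real_norm_sq_eq, hx, one_pow]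
  have h2 : 1 + ‖z‖ ^ 2 / 4 = 2 / (1 + x (Fin.last n)) := by
    rw [EuclideanSpace.real_norm_sq_eq]
    simp only [hz, div_pow, mul_pow, ← Finset.sum_div, ← Finset.mul_sum]
    rw [eq_sub_of_add_eq h1]
    field_simp
    ring
  ext i
  refine Fin.lastCases ?_ (fun j => ?_) i
  · have := one_add_invStereo_last z
    rw [h2, inv_div] at this
    linarith
  · rw [invStereo_castSucc, h2, hz]
    field_simp

theorem image_eq_preimage_invStereo {P : Set (EuclideanSpace ℝ (Fin (n + 1)))}
    (hP : ∀ x ∈ P, ‖x‖ = 1 ∧ 0 < 1 + x (Fin.last n))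
    {g : EuclideanSpace ℝ (Fin (n + 1)) → EuclideanSpace ℝ (Fin n)}
    (hg : ∀ x, ∀ j : Fin n, g x j = 2 * x j.castSucc / (1 + x (Fin.last n))) :
    g '' P = invStereo (insertCoord (Fin.last n)) ⁻¹' P := by
  ext z
  constructor
  · rintro ⟨x, hx, rfl⟩
    rwa [Set.mem_preimage, invStereo_stereographic (hP x hx).1 (hP x hx).2 (hg x)]
  · intro hz
    refine ⟨_, hz, ?_⟩
    ext j
    have : (1 + ‖z‖ ^ 2 / 4) ≠ 0 := by positivity
    rw [hg, one_add_invStereo_last, invStereo_castSucc]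
    field_simp

theorem setIntegral_image_stereographic [NeZero n] {P : Set (EuclideanSpace ℝ (Fin (n + 1)))}
    (hPm : MeasurableSet P) (hP : ∀ x ∈ P, ‖x‖ = 1 ∧ 0 < 1 + x (Fin.last n))
    {g : EuclideanSpace ℝ (Fin (n + 1)) → EuclideanSpace ℝ (Fin n)}
    (hg : ∀ x, ∀ j : Fin n, g x j = 2 * x j.castSucc / (1 + x (Fin.last n))) (ε : ℝ) :
    ∫ y in g '' P, ((y 0 : ℂ) - ε * Complex.I) ^ (-(n : ℤ)) =
      ∫ x in (Subtype.val ⁻¹' P : Set (sphere (0 : EuclideanSpace ℝ (Fin (n + 1))) 1)),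
        ((x.1 0 : ℂ) - (ε * ((1 + x.1 (Fin.last n)) / 2) : ℝ) * Complex.I) ^ (-(n : ℤ))
          ∂(sphereMeasure n) := by
  have : Nontrivial (EuclideanSpace ℝ (Fin n)) :=
    Module.nontrivial_of_finrank_pos (R := ℝ) (by simpa using Nat.pos_of_ne_zero (NeZero.ne n))
  set f : EuclideanSpace ℝ (Fin (n + 1)) → ℂ := fun x =>
    ((x 0 : ℂ) - (ε * ((1 + x (Fin.last n)) / 2) : ℝ) * Complex.I) ^ (-(n : ℤ)) with hf
  have hfm : Measurable (P.indicator f) := by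
    refine Measurable.indicator ?_ hPm
    simp only [hf, zpow_neg, zpow_natCast]
    have h0 : ∀ i, Measurable fun x : EuclideanSpace ℝ (Fin (n + 1)) => x i := fun i => by fun_prop
    have h1 := h0 0
    have h2 := h0 (Fin.last n)
    fun_prop
  have hge : MeasurableSet (g '' P) := by
    rw [image_eq_preimage_invStereo hP hg]
    exact (isAxis_insertCoord (Fin.last n)).measurable_invStereo hPm
  rw [← integral_indicator hge, image_eq_preimage_invStereo hP hg]
  change _ = ∫ x in (Subtype.val ⁻¹' P : Set (sphere (0 : EuclideanSpace ℝ (Fin (n + 1))) 1)),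
    f x ∂(sphereMeasure n)
  rw [← integral_indicator (measurable_subtype_coe hPm)]
  refine Eq.trans ?_ ((isAxis_insertCoord (Fin.last n)).integral_toSphere_stereographic hfm).symm
  refine integral_congr_ae (ae_of_all _ fun z => ?_)
  by_cases hz : invStereo (insertCoord (Fin.last n)) z ∈ P
  · have h1 : ((1 + ‖z‖ ^ 2 / 4 : ℝ) : ℂ) ≠ 0 := by
      exact_mod_cast (by positivity : (1 + ‖z‖ ^ 2 / 4) ≠ 0)
    have h0 := invStereo_castSucc z 0
    rw [Fin.castSucc_zero'] at h0
    simp only [Set.indicator_of_mem hz, hf]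
    rw [Set.indicator_of_mem (show z ∈ invStereo (insertCoord (Fin.last n)) ⁻¹' P from hz),
      one_add_invStereo_last, h0, Complex.real_smul, finrank_euclideanSpace_fin, zpow_neg,
      zpow_natCast, zpow_neg, zpow_natCast, Complex.ofReal_pow, ← inv_pow, ← inv_pow, ← mul_pow,
      Complex.ofReal_inv, ← mul_inv]
    congr 2
    generalize 1 + ‖z‖ ^ 2 / 4 = q at h1 ⊢
    push_cast
    field_simp
  · simp only [Set.indicator_of_notMem hz, smul_zero]
    exact Set.indicator_of_notMem
      (show z ∉ invStereo (insertCoord (Fin.last n)) ⁻¹' P from hz) _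

end HalfSpace

/-- A smooth positive function on the line which agrees with the identity on `[c₀, ∞)`. -/
theorem exists_smooth_pos_eq_id {c₀ : ℝ} (hc₀ : 0 < c₀) :
    ∃ φ : ℝ → ℝ, ContDiff ℝ (⊤ : ℕ∞) φ ∧ (∀ t, c₀ / 2 ≤ φ t) ∧ ∀ t, c₀ ≤ t → φ t = t := by
  refine ⟨fun t => c₀ / 2 + (t - c₀ / 2) * Real.smoothTransition ((t - c₀ / 2) / (c₀ / 2)),
    ?_, fun t => ?_, fun t ht => ?_⟩
  · have := Real.smoothTransition.contDiff (n := (⊤ : ℕ∞))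
    fun_prop
  · beta_reduce
    rcases le_total t (c₀ / 2) with h | h
    · rw [Real.smoothTransition.zero_of_nonpos]
      · simp
      · exact div_nonpos_of_nonpos_of_nonneg (by linarith) (by linarith)
    · have := mul_nonneg (sub_nonneg.2 h)
        (Real.smoothTransition.nonneg ((t - c₀ / 2) / (c₀ / 2)))
      linarith
  · beta_reduce
    rw [Real.smoothTransition.one_of_one_le]
    · ring
    · rw [one_le_div (by linarith)]
      linarith

/-- **Proposition 7.2**: the hemisphere-model volume `μ_h(P)` agrees with the upper
half-space-model volume `μ_u(g(P))`, where `g` is the stereographic projection from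
`(0, …, 0, -1)` to the hyperplane `x_n = 1`, written in the first `n` coordinates:
both limits exist and are equal. -/
theorem dh_hemisphere_eq_halfspace_volume (n : ℕ) (hn : 1 ≤ n)
    (P : Set (EuclideanSpace ℝ (Fin (n + 1))))
    (hP : IsSphericalDHPolytope n P)
    (t₀ : ℝ) (ht₀ : -1 < t₀)
    (hPt : ∀ x ∈ P, t₀ ≤ x ⟨n, by omega⟩)
    (g : EuclideanSpace ℝ (Fin (n + 1)) → EuclideanSpace ℝ (Fin n))
    (hg : ∀ x, ∀ j : Fin n, g x j = 2 * x j.castSucc / (1 + x ⟨n, by omega⟩)) :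
    ∃ L : ℂ,
      Tendsto
        (fun ε : ℝ =>
          ∫ x in (Subtype.val ⁻¹' P :
              Set (sphere (0 : EuclideanSpace ℝ (Fin (n + 1))) 1)),
            (((x : EuclideanSpace ℝ (Fin (n + 1))) 0 : ℂ) - (ε : ℂ) * Complex.I) ^ (-(n : ℤ))
            ∂(sphereMeasure n))
        (nhdsWithin 0 (Set.Ioi 0)) (nhds L) ∧
      Tendsto
        (fun ε : ℝ =>
          ∫ y in g '' P, ((y ⟨0, by omega⟩ : ℂ) - (ε : ℂ) * Complex.I) ^ (-(n : ℤ)))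
        (nhdsWithin 0 (Set.Ioi 0)) (nhds L) := by
  have : NeZero n := ⟨by omega⟩
  have hPm := hP.isClosed.measurableSet
  obtain ⟨S, hS, hPS⟩ := hP
  have hP1 : ∀ x ∈ P, ‖x‖ = 1 ∧ 0 < 1 + x (Fin.last n) := fun x hx =>
    ⟨mem_sphere_zero_iff_norm.1 (hPS ▸ hx).1, by
      have := hPt x hx
      change t₀ ≤ x (Fin.last n) at this
      linarith⟩
  obtain ⟨L, -, hL⟩ := convergesOn_polyhedron n (EuclideanSpace ℝ (Fin n)) (by simp)
    (equatorialConstraints S) 1 zero_le_one (fun _ => Complex.I ^ n) contDiff_const 0 n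
  simp only [pow_zero, one_mul] at hL
  obtain ⟨φ, hφ, hφ1, hφ2⟩ := exists_smooth_pos_eq_id (c₀ := (1 + t₀) / 2) (by linarith)
  have hlast : ∀ x : EuclideanSpace ℝ (Fin (n + 1)),
      dropFirst x ⟨n - 1, by omega⟩ = x (Fin.last n) := fun x => by
    rw [dropFirst_apply]
    exact congrArg x.ofLp (Fin.ext (Nat.sub_add_cancel hn))
  have hone : IsRegularization fun _ : EuclideanSpace ℝ (Fin n) => (1 : ℝ) :=
    ⟨contDiff_const, 1, one_pos, fun _ => le_rfl⟩
  have hreg : IsRegularization fun x : EuclideanSpace ℝ (Fin n) =>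
      φ ((1 + x ⟨n - 1, by omega⟩) / 2) :=
    ⟨hφ.comp (by fun_prop), (1 + t₀) / 2 / 2, by linarith, fun x => hφ1 _⟩
  refine ⟨L, (hL _ hone).congr' ?_, (hL _ hreg).congr' ?_⟩
  · filter_upwards [self_mem_nhdsWithin] with ε hε
    rw [← setIntegral_hemisphereDensity hn hS hPS hone hε]
    simp only [hemisphereDensity, mul_one]
  · filter_upwards [self_mem_nhdsWithin] with ε hε
    rw [← setIntegral_hemisphereDensity hn hS hPS hreg hε]
    refine Eq.trans ?_ (setIntegral_image_stereographic hPm hP1 hg ε).symm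
    refine setIntegral_congr_fun (measurable_subtype_coe hPm) fun x hx => ?_
    have h := hPt x hx
    change t₀ ≤ x.1 (Fin.last n) at h
    simp only [hemisphereDensity, hlast]
    rw [hφ2 _ (by linarith)]
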